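/- Fix γ > 1 and β > 1. Let z be a vertex on the main part of a branch of order 1 of the configuration η = η(γ), let P be the unique self-avoiding infinite path in η starting from z, and let η** be the configuration obtained from η by removing every trap whose anchor lies on P. Then the β-biased random walk Z_t = (X_t,Y_t) started at z on η** satisfies lim_{t→∞} X_t/t = (β−1)/(β+1) almost surely. -/

import Mathlib

open MeasureTheory Filter
open scoped ENNReal

noncomputable section

/-- Vertices of the square lattice. -/
abbrev V : Type := ℤ × ℤ

/-- Adjacency in the square lattice ℤ²: Euclidean distance one. -/
def latAdj (u v : V) : Prop := (u.1 - v.1) ^ 2 + (u.2 - v.2) ^ 2 = 1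

instance : MeasurableSpace (Sym2 V) := ⊤

open scoped Classical in
/-- One-step transition probability of the β-biased random walk on the subgraph of ℤ²
with edge set `G`: if the set `Λ` of neighbours of `z` is nonempty and contains the right
neighbour `(z.1+1, z.2)`, step to it with probability `β/(β+|Λ|-1)` and to each other
neighbour with probability `1/(β+|Λ|-1)`; if `Λ` does not contain the right neighbour, step
uniformly in `Λ`; if `Λ` is empty, stay put. -/
def transProb (β : ℝ) (G : Set (Sym2 V)) (z w : V) : ℝ :=
  if {u : V | s(z, u) ∈ G} = ∅ then (if w = z then 1 else 0)
  else
    if s(z, w) ∈ G then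
      (if s(z, ((z.1 + 1, z.2) : V)) ∈ G then
        (if w = ((z.1 + 1, z.2) : V) then
          β / (β + ({u : V | s(z, u) ∈ G}.ncard : ℝ) - 1)
        else 1 / (β + ({u : V | s(z, u) ∈ G}.ncard : ℝ) - 1))
      else 1 / ({u : V | s(z, u) ∈ G}.ncard : ℝ))
    else 0

/-- `μ` is the law of the β-biased random walk on the subgraph of ℤ² with edge set `G`,
started at `z₀`: a probability measure on trajectories whose cylinder probabilities are
the products of the one-step transition probabilities. -/
def IsWalkLaw (β : ℝ) (G : Set (Sym2 V)) (z₀ : V) (μ : Measure (ℕ → V)) : Prop :=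
  IsProbabilityMeasure μ ∧
    ∀ (n : ℕ) (f : ℕ → V), f 0 = z₀ →
      μ {ω | ∀ i ≤ n, ω i = f i} =
        ENNReal.ofReal (∏ i ∈ Finset.range n, transProb β G (f i) (f (i + 1)))

/-- The trap with anchor `(d, y)`, entrance length `e` (at height `y+1`, running leftward
from the anchor) and core length `c` (at height `y+2`, running rightward). -/
def trapEdgesAt (d y : ℤ) (e c : ℕ) : Set (Sym2 V) :=
  {s((d, y), (d, y + 1)), s((d - e, y + 1), (d - e, y + 2))} ∪
    {f | ∃ i : ℕ, i < e ∧ f = s((d - e + i, y + 1), (d - e + i + 1, y + 1))} ∪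
    {f | ∃ i : ℕ, i < c ∧ f = s((d - e + i, y + 2), (d - e + i + 1, y + 2))}

/-- `b_k = 4 · 3^{k(k-1)/2}`. -/
def bF (k : ℕ) : ℕ := 4 * 3 ^ (k * (k - 1) / 2)

/-- `q_k = 3^k - 1`. -/
def qF (k : ℕ) : ℕ := 3 ^ k - 1

open scoped Classical in
/-- Direction of the abutment of a branch on row index `l` (odd): `+1` if `(l+1)/2` is odd
(so that the root lands on a row reserved for branches of the next order), `-1` otherwise. -/
def dirF (l : ℤ) : ℤ := if Odd ((l + 1) / 2) then 1 else -1

/-- The set of x-coordinates of tips of order-`k` branches of the fractal configuration: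
`0` is a tip of every order, and if `x` is an order-`(k+1)` tip then `x + (j-1)·b_k` is an
order-`k` tip for every `1 ≤ j ≤ q_k` (the order-`k` branches attached to the order-`(k+1)`
branch with tip `x` have their roots at `x + j·b_k - 1`, hence their tips at `x + (j-1)·b_k`). -/
inductive IsTip : ℕ → ℤ → Prop
  | zero (k : ℕ) : IsTip k 0
  | step (k : ℕ) (x : ℤ) (j : ℕ) : IsTip (k + 1) x → 1 ≤ j → j ≤ qF k →
      IsTip k (x + ((j : ℤ) - 1) * (bF k : ℤ))

/-- The y-coordinate of the row with index `l` reserved for order-`k` branches: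
`y = 3 · 2^{k-1} · l` (`l` odd). -/
def rowY (k : ℕ) (l : ℤ) : ℤ := 3 * 2 ^ (k - 1) * l

/-- The fractal configuration ξ: for every order `k ≥ 1`, every odd `l` and every order-`k`
tip `x`, the main part of the branch (the `b_k - 1` horizontal edges from the tip
`(x, 3·2^{k-1}·l)` to the corner `(x + b_k - 1, 3·2^{k-1}·l)`) together with its abutment
(the `3·2^{k-1}` vertical edges from the corner to the root, in the direction `dirF l`). -/
def xiEdges : Set (Sym2 V) :=
  {f | ∃ (k : ℕ) (l x : ℤ), 1 ≤ k ∧ Odd l ∧ IsTip k x ∧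
    ((∃ i : ℕ, i + 2 ≤ bF k ∧
        f = s((x + i, rowY k l), (x + i + 1, rowY k l))) ∨
      (∃ j : ℕ, j < 3 * 2 ^ (k - 1) ∧
        f = s((x + bF k - 1, rowY k l + dirF l * j),
              (x + bF k - 1, rowY k l + dirF l * (j + 1)))))}

/-- `z` lies on the main part of the order-`k` branch with row index `l` and tip
x-coordinate `x`. -/
def OnMainPart (k : ℕ) (l x : ℤ) (z : V) : Prop :=
  z.2 = rowY k l ∧ x ≤ z.1 ∧ z.1 ≤ x + bF k - 1

/-- Core length of the trap attached to an order-`k` branch: `c_k = 3^{(k-1)(k-2)/2}`. -/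
def cF (k : ℕ) : ℕ := 3 ^ ((k - 1) * (k - 2) / 2)

/-- Entrance length of the trap attached to an order-`k` branch:
`e_k = min{⌈log k / log γ⌉, 3^{(k-1)(k-2)/2}}`. -/
def eF (γ : ℝ) (k : ℕ) : ℕ := min ⌈Real.log k / Real.log γ⌉₊ (cF k)

/-- The x-coordinate of the anchor of the trap attached to the order-`k` branch with tip
x-coordinate `x`: `2 · 3^{(k-1)(k-2)/2}` steps to the left of the corner. -/
def anchorX (k : ℕ) (x : ℤ) : ℤ := x + bF k - 1 - 2 * (cF k : ℤ)

/-- The trap attached to the order-`k` branch with row index `l` and tip x-coordinate `x`. -/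
def branchTrap (γ : ℝ) (k : ℕ) (l x : ℤ) : Set (Sym2 V) :=
  trapEdgesAt (anchorX k x) (rowY k l) (eF γ k) (cF k)

/-- The configuration η = η(γ): the fractal configuration ξ with one trap attached to each
branch of order `k ≥ 2`. -/
def etaEdges (γ : ℝ) : Set (Sym2 V) :=
  xiEdges ∪
    {f | ∃ (k : ℕ) (l x : ℤ), 2 ≤ k ∧ Odd l ∧ IsTip k x ∧ f ∈ branchTrap γ k l x}

/-- The chain of branches traversed by the unique self-avoiding infinite path of η starting
on the order-1 branch with data `(L 1, X 1)`: the order-`(k+1)` branch of the chain is the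
one containing the root of the order-`k` branch of the chain, so its row index is
`(L k + dirF (L k))/2` and its tip is the unique order-`(k+1)` tip `X (k+1)` with
`X (k+1) ≤ X k < X (k+1) + b_{k+1}`. -/
def IsBranchChain (L X : ℕ → ℤ) : Prop :=
  ∀ k : ℕ, 1 ≤ k →
    L (k + 1) = (L k + dirF (L k)) / 2 ∧ IsTip (k + 1) (X (k + 1)) ∧
      X (k + 1) ≤ X k ∧ X k < X (k + 1) + bF (k + 1)

section

/-- The four lattice neighbours of a vertex. -/
def nbrs (v : V) : Finset V := {(v.1 + 1, v.2), (v.1 - 1, v.2), (v.1, v.2 + 1), (v.1, v.2 - 1)}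

/-- A set of edges of the square lattice. -/
def IsLatticeGraph (G : Set (Sym2 V)) : Prop := ∀ v w : V, s(v, w) ∈ G → w ∈ nbrs v

open scoped Classical in
/-- Conductance of the pair `v, w`: `β` to the power of the larger abscissa if `s(v, w)` is an
edge of `G`, and zero otherwise. -/
def conductance (β : ℝ) (G : Set (Sym2 V)) (v w : V) : ℝ :=
  if s(v, w) ∈ G then β ^ (max v.1 w.1) else 0

/-- Total conductance at a vertex. -/
def totalCond (β : ℝ) (G : Set (Sym2 V)) (v : V) : ℝ := ∑ w ∈ nbrs v, conductance β G v w

lemma sum_nbrs {M : Type*} [AddCommMonoid M] (v : V) (f : V → M) :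
    ∑ w ∈ nbrs v, f w = f (v.1 + 1, v.2) + (f (v.1 - 1, v.2) + (f (v.1, v.2 + 1) +
      f (v.1, v.2 - 1))) := by
  unfold nbrs
  rw [Finset.sum_insert, Finset.sum_insert, Finset.sum_insert, Finset.sum_singleton] <;>
    simp only [Finset.mem_insert, Finset.mem_singleton, Prod.mk.injEq] <;> omega

lemma mem_nbrs {v w : V} : w ∈ nbrs v ↔ w = (v.1 + 1, v.2) ∨ w = (v.1 - 1, v.2) ∨
    w = (v.1, v.2 + 1) ∨ w = (v.1, v.2 - 1) := by
  simp [nbrs]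

lemma notMem_nbrs_self (v : V) : v ∉ nbrs v := by
  simp only [mem_nbrs, Prod.ext_iff]
  omega

variable {β : ℝ} {G : Set (Sym2 V)}

lemma conductance_comm (v w : V) : conductance β G v w = conductance β G w v := by
  unfold conductance; rw [Sym2.eq_swap, max_comm]

lemma conductance_nonneg (hβ : 1 < β) (v w : V) : 0 ≤ conductance β G v w := by
  unfold conductance; split_ifs <;> positivity

lemma conductance_of_mem {v w : V} (h : s(v, w) ∈ G) : conductance β G v w = β ^ (max v.1 w.1) := by
  simp [conductance, h]

lemma conductance_of_notMem {v w : V} (h : s(v, w) ∉ G) : conductance β G v w = 0 := by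
  simp [conductance, h]

lemma totalCond_nonneg (hβ : 1 < β) (v : V) : 0 ≤ totalCond β G v :=
  Finset.sum_nonneg fun _ _ => conductance_nonneg hβ _ _

lemma totalCond_pos (hβ : 1 < β) (hG : IsLatticeGraph G) {v w : V} (h : s(v, w) ∈ G) :
    0 < totalCond β G v := by
  refine Finset.sum_pos' (fun _ _ => conductance_nonneg hβ _ _) ⟨w, hG v w h, ?_⟩
  rw [conductance_of_mem h]; positivity

lemma totalCond_le (hβ : 1 < β) (v : V) : totalCond β G v ≤ 4 * β * β ^ v.1 := by
  have h0 : (0 : ℝ) < β ^ v.1 := by positivity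
  have hle : ∀ w ∈ nbrs v, conductance β G v w ≤ β * β ^ v.1 := by
    intro w hw
    unfold conductance
    split_ifs
    · rw [← zpow_one_add₀ (by positivity)]
      refine zpow_le_zpow_right₀ hβ.le ?_
      rcases mem_nbrs.1 hw with h | h | h | h <;> rw [h] <;> simp
    · positivity
  refine (Finset.sum_le_card_nsmul _ _ _ hle).trans ?_
  have hc : ((nbrs v).card : ℝ) ≤ 4 := by exact_mod_cast Finset.card_le_four
  rw [nsmul_eq_mul, mul_assoc 4]
  gcongr

lemma transProb_of_isolated {v : V} (h : ∀ u, s(v, u) ∉ G) (w : V) :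
    transProb β G v w = if w = v then 1 else 0 := by
  have : {u : V | s(v, u) ∈ G} = ∅ := by ext u; simp [h u]
  unfold transProb; rw [if_pos this]

open scoped Classical in
lemma totalCond_eq (hβ : 1 < β) (hG : IsLatticeGraph G) (v : V) :
    totalCond β G v = β ^ v.1 * (({u : V | s(v, u) ∈ G}.ncard : ℝ) +
      if s(v, ((v.1 + 1, v.2) : V)) ∈ G then β - 1 else 0) := by
  have hset : {u : V | s(v, u) ∈ G} = ((nbrs v).filter fun u => s(v, u) ∈ G : Finset V) := by
    ext u; simp only [Set.mem_ofPred_eq, Finset.coe_filter]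
    exact ⟨fun h => ⟨hG _ _ h, h⟩, fun h => h.2⟩
  rw [hset, Set.ncard_coe_finset, Finset.card_filter, totalCond]
  push_cast
  rw [sum_nbrs, sum_nbrs]
  simp only [conductance]
  have h1 : β ^ (v.1 + 1) = β ^ v.1 * β := zpow_add_one₀ (by positivity) _
  simp only [max_self, le_add_iff_nonneg_right, zero_le_one, max_eq_right, h1,
    show max v.1 (v.1 - 1) = v.1 by omega]
  split_ifs <;> ring

lemma transProb_eq (hβ : 1 < β) (hG : IsLatticeGraph G) {v u : V} (h : s(v, u) ∈ G) (w : V) :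
    transProb β G v w = conductance β G v w / totalCond β G v := by
  have hne : {u : V | s(v, u) ∈ G} ≠ ∅ := fun h' => by
    have : u ∈ {u : V | s(v, u) ∈ G} := h
    rw [h'] at this; exact this
  have hpos := totalCond_pos hβ hG h
  have hT := totalCond_eq hβ hG v
  have h0 : (0 : ℝ) < β ^ v.1 := by positivity
  unfold transProb
  rw [if_neg hne]
  by_cases hw : s(v, w) ∈ G
  · rw [if_pos hw, conductance_of_mem hw, hT]
    rw [hT] at hpos
    have hp := (mul_pos_iff_of_pos_left h0).1 hpos
    by_cases hr : s(v, ((v.1 + 1, v.2) : V)) ∈ G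
    · simp only [if_pos hr] at hp ⊢
      by_cases hwr : w = (v.1 + 1, v.2)
      · rw [if_pos hwr, hwr]
        have h1 : β ^ (v.1 + 1) = β ^ v.1 * β := zpow_add_one₀ (by positivity) _
        simp only [le_add_iff_nonneg_right, zero_le_one, max_eq_right, h1]
        rw [mul_div_mul_left _ _ h0.ne']
        congr 1; ring
      · have hmax : max v.1 w.1 = v.1 := by
          rcases mem_nbrs.1 (hG _ _ hw) with h | h | h | h
          · exact absurd h hwr
          all_goals rw [h]; simp
        rw [if_neg hwr, hmax, div_mul_eq_div_div, div_self h0.ne']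
        congr 1; ring
    · simp only [if_neg hr] at hp ⊢
      have hmax : max v.1 w.1 = v.1 := by
        rcases mem_nbrs.1 (hG _ _ hw) with h | h | h | h
        · rw [h] at hw; exact absurd hw hr
        all_goals rw [h]; simp
      rw [hmax, div_mul_eq_div_div, div_self h0.ne', add_zero]
  · rw [if_neg hw, conductance_of_notMem hw, zero_div]

lemma transProb_nonneg (hβ : 1 < β) (hG : IsLatticeGraph G) (v w : V) :
    0 ≤ transProb β G v w := by
  by_cases h : ∃ u, s(v, u) ∈ G
  · obtain ⟨u, hu⟩ := h
    rw [transProb_eq hβ hG hu]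
    exact div_nonneg (conductance_nonneg hβ _ _) (totalCond_nonneg hβ _)
  · push Not at h
    rw [transProb_of_isolated h]; split_ifs <;> simp

lemma transProb_eq_zero (hβ : 1 < β) (hG : IsLatticeGraph G) {v w : V}
    (hw : w ∉ insert v (nbrs v)) : transProb β G v w = 0 := by
  simp only [Finset.mem_insert, not_or] at hw
  by_cases h : ∃ u, s(v, u) ∈ G
  · obtain ⟨u, hu⟩ := h
    rw [transProb_eq hβ hG hu, conductance_of_notMem fun h' => hw.2 (hG _ _ h'), zero_div]
  · push Not at h
    rw [transProb_of_isolated h, if_neg hw.1]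

lemma sum_transProb (hβ : 1 < β) (hG : IsLatticeGraph G) (v : V) :
    ∑ w ∈ insert v (nbrs v), transProb β G v w = 1 := by
  rw [Finset.sum_insert (notMem_nbrs_self v)]
  by_cases h : ∃ u, s(v, u) ∈ G
  · obtain ⟨u, hu⟩ := h
    have hself : s(v, v) ∉ G := fun h' => notMem_nbrs_self v (hG _ _ h')
    simp only [transProb_eq hβ hG hu]
    rw [conductance_of_notMem hself, zero_div, zero_add, ← Finset.sum_div]
    exact div_self (totalCond_pos hβ hG hu).ne'
  · push Not at h
    simp only [transProb_of_isolated h, if_true]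
    rw [Finset.sum_eq_zero, add_zero]
    intro w hw
    rw [if_neg]
    rintro rfl
    exact notMem_nbrs_self _ hw

/-- Expected horizontal displacement of the walk in one step from `v`. -/
def drift (β : ℝ) (G : Set (Sym2 V)) (v : V) : ℝ :=
  ∑ w ∈ insert v (nbrs v), transProb β G v w * ((w.1 : ℝ) - v.1)

lemma abs_sub_le_one_of_mem {v w : V} (hw : w ∈ insert v (nbrs v)) :
    |(w.1 : ℝ) - v.1| ≤ 1 := by
  rw [Finset.mem_insert, mem_nbrs] at hw
  rcases hw with h | h | h | h | h <;> rw [h] <;> simp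

lemma abs_drift_le_one (hβ : 1 < β) (hG : IsLatticeGraph G) (v : V) : |drift β G v| ≤ 1 := by
  refine (Finset.abs_sum_le_sum_abs _ _).trans ?_
  rw [← sum_transProb hβ hG v]
  refine Finset.sum_le_sum fun w hw => ?_
  rw [abs_mul, abs_of_nonneg (transProb_nonneg hβ hG _ _)]
  exact mul_le_of_le_one_right (transProb_nonneg hβ hG _ _) (abs_sub_le_one_of_mem hw)

/-- A vertex whose neighbours are exactly the vertices to its left and to its right. -/
def IsFlat (G : Set (Sym2 V)) (v : V) : Prop :=
  {u : V | s(v, u) ∈ G} = {(v.1 + 1, v.2), (v.1 - 1, v.2)}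

lemma drift_of_isFlat (hβ : 1 < β) (hG : IsLatticeGraph G) {v : V} (h : IsFlat G v) :
    drift β G v = (β - 1) / (β + 1) := by
  have hmem : ∀ u, s(v, u) ∈ G ↔ u = (v.1 + 1, v.2) ∨ u = (v.1 - 1, v.2) := fun u => by
    have := Set.ext_iff.1 h u
    simpa using this
  have hr : s(v, ((v.1 + 1, v.2) : V)) ∈ G := (hmem _).2 (Or.inl rfl)
  have hl : s(v, ((v.1 - 1, v.2) : V)) ∈ G := (hmem _).2 (Or.inr rfl)
  have hu : s(v, ((v.1, v.2 + 1) : V)) ∉ G := by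
    rw [hmem]; simp [Prod.ext_iff]
  have hd : s(v, ((v.1, v.2 - 1) : V)) ∉ G := by
    rw [hmem]; simp [Prod.ext_iff]
  have h0 : (0 : ℝ) < β ^ v.1 := by positivity
  have h1 : β ^ (v.1 + 1) = β ^ v.1 * β := zpow_add_one₀ (by positivity) _
  have hT : totalCond β G v = β ^ v.1 * (β + 1) := by
    rw [totalCond, sum_nbrs, conductance_of_mem hr, conductance_of_mem hl, conductance_of_notMem hu,
      conductance_of_notMem hd]
    simp only [le_add_iff_nonneg_right, zero_le_one, max_eq_right, h1,
      show max v.1 (v.1 - 1) = v.1 by omega]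
    ring
  rw [drift, Finset.sum_insert (notMem_nbrs_self v), sum_nbrs]
  simp only [transProb_eq hβ hG hr]
  rw [conductance_of_mem hr, conductance_of_mem hl, conductance_of_notMem hu, conductance_of_notMem hd, hT]
  simp only [le_add_iff_nonneg_right, zero_le_one, max_eq_right, h1,
      show max v.1 (v.1 - 1) = v.1 by omega]
  push_cast
  have : β + 1 ≠ 0 := by positivity
  field_simp
  ring

lemma sum_transProb_mul_sq_le (hβ : 1 < β) (hG : IsLatticeGraph G) (v : V) (a : ℝ) :
    ∑ w ∈ insert v (nbrs v), transProb β G v w * (a + ((w.1 : ℝ) - v.1 - drift β G v)) ^ 2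
      ≤ a ^ 2 + 4 := by
  have hexp : ∀ w, transProb β G v w * (a + ((w.1 : ℝ) - v.1 - drift β G v)) ^ 2 =
      a ^ 2 * transProb β G v w + 2 * a * (transProb β G v w * ((w.1 : ℝ) - v.1)) -
      2 * a * drift β G v * transProb β G v w +
      transProb β G v w * ((w.1 : ℝ) - v.1 - drift β G v) ^ 2 := fun w => by ring
  simp only [hexp]
  rw [Finset.sum_add_distrib, Finset.sum_sub_distrib, Finset.sum_add_distrib, ← Finset.mul_sum,
    ← Finset.mul_sum, ← Finset.mul_sum, sum_transProb hβ hG]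
  have hd : ∑ w ∈ insert v (nbrs v), transProb β G v w * ((w.1 : ℝ) - v.1) = drift β G v := rfl
  rw [hd]
  have h4 : ∑ w ∈ insert v (nbrs v), transProb β G v w * ((w.1 : ℝ) - v.1 - drift β G v) ^ 2
      ≤ ∑ w ∈ insert v (nbrs v), transProb β G v w * 4 := by
    refine Finset.sum_le_sum fun w hw => ?_
    refine mul_le_mul_of_nonneg_left ?_ (transProb_nonneg hβ hG _ _)
    have h1 := abs_le.1 (abs_sub_le_one_of_mem hw)
    have h2 := abs_le.1 (abs_drift_le_one hβ hG v)
    nlinarith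
  rw [← Finset.sum_mul, sum_transProb hβ hG] at h4
  linarith

end

section

variable {β : ℝ} {G : Set (Sym2 V)} {z : V} {μ : Measure (ℕ → V)}

/-- The first `n + 1` positions of a trajectory. -/
def history (n : ℕ) (ω : ℕ → V) : Fin (n + 1) → V := fun i => ω i

lemma measurable_history (n : ℕ) : Measurable (history n) :=
  measurable_pi_lambda _ fun _ => measurable_pi_apply _

lemma IsWalkLaw.ae_start (hμ : IsWalkLaw β G z μ) : ∀ᵐ ω ∂μ, ω 0 = z := by
  have := hμ.1
  have h := hμ.2 0 (fun _ => z) rfl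
  simp only [Finset.range_zero, Finset.prod_empty, ENNReal.ofReal_one, nonpos_iff_eq_zero,
    forall_eq] at h
  have hm : MeasurableSet {ω : ℕ → V | ω 0 = z} :=
    (measurable_pi_apply (X := fun _ : ℕ => V) 0) (measurableSet_singleton z)
  exact (prob_compl_eq_zero_iff hm).2 h

lemma IsWalkLaw.cylinder_succ (hμ : IsWalkLaw β G z μ) (hβ : 1 < β) (hG : IsLatticeGraph G)
    (n : ℕ) (f : ℕ → V) :
    μ {ω | ∀ i ≤ n + 1, ω i = f i} =
      μ {ω | ∀ i ≤ n, ω i = f i} * ENNReal.ofReal (transProb β G (f n) (f (n + 1))) := by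
  by_cases h0 : f 0 = z
  · rw [hμ.2 _ f h0, hμ.2 _ f h0, Finset.prod_range_succ, ENNReal.ofReal_mul]
    exact Finset.prod_nonneg fun _ _ => transProb_nonneg hβ hG _ _
  · have hz : ∀ m, μ {ω | ∀ i ≤ m, ω i = f i} = 0 := fun m => by
      refine measure_mono_null ?_ hμ.ae_start
      intro ω hω h
      exact h0 ((hω 0 (Nat.zero_le _)).symm.trans h)
    rw [hz, hz, zero_mul]

lemma IsWalkLaw.measure_history_succ (hμ : IsWalkLaw β G z μ) (hβ : 1 < β)
    (hG : IsLatticeGraph G) (n : ℕ) (g : Fin (n + 1) → V) (w : V) :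
    μ {ω | history n ω = g ∧ ω (n + 1) = w} =
      μ {ω | history n ω = g} * ENNReal.ofReal (transProb β G (g (Fin.last n)) w) := by
  set f : ℕ → V := fun i => if h : i < n + 1 then g ⟨i, h⟩ else w with hf
  have hfn : f n = g (Fin.last n) := by simp [hf, Fin.last]
  have hfs : f (n + 1) = w := by simp [hf]
  have hist : ∀ ω, history n ω = g ↔ ∀ i ≤ n, ω i = f i := by
    intro ω
    constructor
    · rintro rfl i hi
      simp only [hf]
      rw [dif_pos (Nat.lt_succ_of_le hi)]
      rfl
    · intro h
      ext1 i
      have := h i (Nat.lt_succ_iff.1 i.2)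
      simp only [hf] at this
      rwa [dif_pos i.2] at this
  have h := hμ.cylinder_succ hβ hG n f
  rw [hfn, hfs] at h
  simp only [hist]
  rw [← h]
  congr 1
  ext ω
  simp only [Set.mem_ofPred_eq]
  constructor
  · rintro ⟨h1, h2⟩ i hi
    rcases Nat.le_succ_iff.1 hi with h | h
    · exact h1 i h
    · rw [h, ← Nat.succ_eq_add_one] at *; rw [h2]; exact hfs.symm
  · intro h
    exact ⟨fun i hi => h i (by omega), (h (n + 1) le_rfl).trans hfs⟩

/-- The Markov property, for nonnegative functions of the history and the next position. -/
lemma IsWalkLaw.lintegral_step (hμ : IsWalkLaw β G z μ) (hβ : 1 < β) (hG : IsLatticeGraph G)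
    (n : ℕ) (ψ : (Fin (n + 1) → V) → V → ℝ≥0∞) :
    ∫⁻ ω, ψ (history n ω) (ω (n + 1)) ∂μ =
      ∫⁻ ω, ∑ w ∈ insert (ω n) (nbrs (ω n)),
        ENNReal.ofReal (transProb β G (ω n) w) * ψ (history n ω) w ∂μ := by
  have hm1 : Measurable fun ω : ℕ → V => (history n ω, ω (n + 1)) :=
    (measurable_history n).prodMk (measurable_pi_apply _)
  have hL : ∫⁻ ω, ψ (history n ω) (ω (n + 1)) ∂μ =
      ∑' g : Fin (n + 1) → V, ∑' w : V, ψ g w * μ {ω | history n ω = g ∧ ω (n + 1) = w} := by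
    have h1 : ∫⁻ ω, ψ (history n ω) (ω (n + 1)) ∂μ =
        ∫⁻ p, ψ p.1 p.2 ∂(μ.map fun ω : ℕ → V => (history n ω, ω (n + 1))) :=
      (lintegral_map (f := fun p : (Fin (n + 1) → V) × V => ψ p.1 p.2)
        Measurable.of_discrete hm1).symm
    rw [h1, lintegral_countable', ENNReal.tsum_prod']
    refine tsum_congr fun g => tsum_congr fun w => ?_
    rw [Measure.map_apply hm1 (measurableSet_singleton _)]
    congr 2
    ext ω
    simp
  have hR : ∫⁻ ω, ∑ w ∈ insert (ω n) (nbrs (ω n)),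
        ENNReal.ofReal (transProb β G (ω n) w) * ψ (history n ω) w ∂μ =
      ∑' g : Fin (n + 1) → V, (∑ w ∈ insert (g (Fin.last n)) (nbrs (g (Fin.last n))),
        ENNReal.ofReal (transProb β G (g (Fin.last n)) w) * ψ g w) *
          μ {ω | history n ω = g} := by
    have h1 := lintegral_map (μ := μ) (f := fun g : Fin (n + 1) → V =>
      ∑ w ∈ insert (g (Fin.last n)) (nbrs (g (Fin.last n))),
        ENNReal.ofReal (transProb β G (g (Fin.last n)) w) * ψ g w)
      (Measurable.of_discrete) (measurable_history n)
    have h2 : ∀ ω : ℕ → V, history n ω (Fin.last n) = ω n := fun ω => rfl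
    simp only [h2] at h1
    rw [← h1, lintegral_countable']
    refine tsum_congr fun g => ?_
    rw [Measure.map_apply (measurable_history n) (measurableSet_singleton _)]
    rfl
  rw [hL, hR]
  refine tsum_congr fun g => ?_
  rw [Finset.sum_mul, tsum_eq_sum (s := insert (g (Fin.last n)) (nbrs (g (Fin.last n))))]
  · refine Finset.sum_congr rfl fun w _ => ?_
    rw [hμ.measure_history_succ hβ hG]
    ring
  · intro w hw
    rw [hμ.measure_history_succ hβ hG, transProb_eq_zero hβ hG hw]
    simp

lemma IsWalkLaw.ae_transProb_ne_zero (hμ : IsWalkLaw β G z μ) (hβ : 1 < β)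
    (hG : IsLatticeGraph G) : ∀ᵐ ω ∂μ, ∀ n, transProb β G (ω n) (ω (n + 1)) ≠ 0 := by
  classical
  rw [ae_all_iff]
  intro n
  have h := hμ.lintegral_step hβ hG n
    fun g w => if transProb β G (g (Fin.last n)) w = 0 then 1 else 0
  have h2 : ∀ ω : ℕ → V, history n ω (Fin.last n) = ω n := fun ω => rfl
  simp only [h2] at h
  have h3 : ∀ ω : ℕ → V, ∑ w ∈ insert (ω n) (nbrs (ω n)),
      ENNReal.ofReal (transProb β G (ω n) w) *
        (if transProb β G (ω n) w = 0 then 1 else 0) = 0 := fun ω =>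
    Finset.sum_eq_zero fun w _ => by split_ifs with h <;> simp [h]
  simp only [h3, lintegral_zero] at h
  have hm : Measurable fun ω : ℕ → V =>
      if transProb β G (ω n) (ω (n + 1)) = 0 then (1 : ℝ≥0∞) else 0 := by
    have hp : Measurable fun ω : ℕ → V => (ω n, ω (n + 1)) :=
      (measurable_pi_apply _).prodMk (measurable_pi_apply _)
    exact (Measurable.of_discrete (f := fun p : V × V =>
      if transProb β G p.1 p.2 = 0 then (1 : ℝ≥0∞) else 0)).comp hp
  rw [lintegral_eq_zero_iff hm] at h
  filter_upwards [h] with ω hω h0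
  simp [h0] at hω

lemma IsWalkLaw.ae_path (hμ : IsWalkLaw β G z μ) (hβ : 1 < β) (hG : IsLatticeGraph G)
    (hz : ∃ u, s(z, u) ∈ G) : ∀ᵐ ω ∂μ, ω 0 = z ∧ ∀ n, s(ω n, ω (n + 1)) ∈ G := by
  filter_upwards [hμ.ae_start, hμ.ae_transProb_ne_zero hβ hG] with ω h0 hω
  have key : ∀ n, (∃ u, s(ω n, u) ∈ G) → s(ω n, ω (n + 1)) ∈ G := by
    rintro n ⟨u, hu⟩
    by_contra hc
    refine hω n ?_
    rw [transProb_eq hβ hG hu, conductance_of_notMem hc, zero_div]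
  refine ⟨h0, fun n => key n ?_⟩
  induction n with
  | zero => rwa [h0]
  | succ n ih => exact ⟨ω n, by rw [Sym2.eq_swap]; exact key n ih⟩

lemma measurableSet_visit (n : ℕ) (v : V) : MeasurableSet {ω : ℕ → V | ω n = v} :=
  (measurable_pi_apply (X := fun _ : ℕ => V) n) (measurableSet_singleton v)

lemma IsWalkLaw.measureReal_visit_succ (hμ : IsWalkLaw β G z μ) (hβ : 1 < β)
    (hG : IsLatticeGraph G) (n : ℕ) {v u : V} (hv : s(v, u) ∈ G) :
    μ.real {ω | ω (n + 1) = v} =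
      ∑ w ∈ nbrs v, μ.real {ω | ω n = w} * (conductance β G v w / totalCond β G w) := by
  classical
  have := hμ.1
  have h := hμ.lintegral_step hβ hG n fun _ w => if w = v then 1 else 0
  have hl : ∫⁻ ω : ℕ → V, (if ω (n + 1) = v then 1 else 0 : ℝ≥0∞) ∂μ =
      μ {ω | ω (n + 1) = v} := by
    rw [← lintegral_indicator_one (measurableSet_visit (n + 1) v)]
    refine lintegral_congr fun ω => ?_
    simp [Set.indicator_apply]
  have hs : ∀ x : V, ∑ w ∈ insert x (nbrs x),
      ENNReal.ofReal (transProb β G x w) * (if w = v then 1 else 0) =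
        ENNReal.ofReal (transProb β G x v) := by
    intro x
    simp only [mul_ite, mul_one, mul_zero, Finset.sum_ite_eq']
    split_ifs with hx
    · rfl
    · rw [transProb_eq_zero hβ hG hx, ENNReal.ofReal_zero]
  simp only [hs] at h
  rw [hl] at h
  have hr : ∫⁻ ω : ℕ → V, ENNReal.ofReal (transProb β G (ω n) v) ∂μ =
      ∑' x : V, ENNReal.ofReal (transProb β G x v) * μ {ω | ω n = x} := by
    rw [← lintegral_map (μ := μ) (f := fun x => ENNReal.ofReal (transProb β G x v))
      (Measurable.of_discrete) (measurable_pi_apply n), lintegral_countable']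
    refine tsum_congr fun x => ?_
    rw [Measure.map_apply (measurable_pi_apply n) (measurableSet_singleton _)]
    rfl
  have hcond : ∀ x ≠ v, transProb β G x v = conductance β G v x / totalCond β G x := by
    intro x hx
    by_cases h : ∃ y, s(x, y) ∈ G
    · obtain ⟨y, hy⟩ := h
      rw [transProb_eq hβ hG hy, conductance_comm]
    · push Not at h
      rw [transProb_of_isolated h, if_neg hx.symm, conductance_of_notMem, zero_div]
      rw [Sym2.eq_swap]; exact h v
  have hself : transProb β G v v = 0 := by
    rw [transProb_eq hβ hG hv, conductance_of_notMem, zero_div]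
    exact fun h' => notMem_nbrs_self v (hG _ _ h')
  rw [hr, tsum_eq_sum (s := nbrs v)] at h
  · rw [measureReal_def, h, ENNReal.toReal_sum]
    · refine Finset.sum_congr rfl fun w hw => ?_
      have hne : w ≠ v := by rintro rfl; exact notMem_nbrs_self _ hw
      rw [ENNReal.toReal_mul, ENNReal.toReal_ofReal (transProb_nonneg hβ hG _ _), hcond w hne,
        mul_comm, measureReal_def]
    · intro w _
      exact ENNReal.mul_ne_top ENNReal.ofReal_ne_top (measure_ne_top _ _)
  · intro x hx
    by_cases hxv : x = v
    · rw [hxv, hself]; simp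
    · rw [hcond x hxv, conductance_of_notMem fun h' => hx (hG _ _ h')]; simp

/-- The expected number of visits to `v` is bounded through time reversal by a superharmonic
function `u` with unit charge at the starting point. -/
lemma IsWalkLaw.sum_visit_le (hμ : IsWalkLaw β G z μ) (hβ : 1 < β) (hG : IsLatticeGraph G)
    (hz : ∃ u, s(z, u) ∈ G) (Q : Set V) (hQ : ∀ v ∈ Q, ∀ w, s(v, w) ∈ G → w ∈ Q)
    (u : V → ℝ) (hu0 : ∀ v ∈ Q, 0 ≤ u v)
    (hu : ∀ v ∈ Q, (∃ w, s(v, w) ∈ G) →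
      ∑ w ∈ nbrs v, conductance β G v w * u w + (if v = z then 1 else 0) ≤
        totalCond β G v * u v)
    (N : ℕ) (v : V) (hv : v ∈ Q) :
    ∑ n ∈ Finset.range N, μ.real {ω | ω n = v} ≤ totalCond β G v * u v := by
  have := hμ.1
  induction N generalizing v with
  | zero => simpa using mul_nonneg (totalCond_nonneg hβ v) (hu0 v hv)
  | succ N ih =>
    by_cases hiso : ∃ w, s(v, w) ∈ G
    · obtain ⟨y, hy⟩ := hiso
      refine le_trans ?_ (hu v hv ⟨y, hy⟩)
      rw [Finset.sum_range_succ']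
      refine add_le_add ?_ ?_
      · simp only [hμ.measureReal_visit_succ hβ hG _ hy]
        rw [Finset.sum_comm]
        refine Finset.sum_le_sum fun w _ => ?_
        rw [← Finset.sum_mul]
        by_cases hw : s(v, w) ∈ G
        · have hpos : 0 < totalCond β G w :=
            totalCond_pos hβ hG (w := v) (by rwa [Sym2.eq_swap])
          calc (∑ n ∈ Finset.range N, μ.real {ω | ω n = w}) *
                (conductance β G v w / totalCond β G w)
              ≤ (totalCond β G w * u w) * (conductance β G v w / totalCond β G w) :=
                mul_le_mul_of_nonneg_right (ih w (hQ v hv w hw))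
                  (div_nonneg (conductance_nonneg hβ _ _) hpos.le)
            _ = conductance β G v w * u w := by field_simp
        · rw [conductance_of_notMem hw]; simp
      · split_ifs with h
        · exact measureReal_le_one
        · refine le_of_eq ?_
          rw [measureReal_eq_zero_iff]
          refine measure_mono_null ?_ hμ.ae_start
          intro ω hω h'
          exact h ((show ω 0 = v from hω).symm.trans h')
    · rw [Finset.sum_eq_zero]
      · exact mul_nonneg (totalCond_nonneg hβ v) (hu0 v hv)
      · intro n _
        rw [measureReal_eq_zero_iff]
        refine measure_mono_null ?_ (hμ.ae_path hβ hG hz)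
        intro ω hω h'
        exact hiso ⟨ω (n + 1), by rw [← show ω n = v from hω]; exact h'.2 n⟩

end

section

variable {β : ℝ} {G : Set (Sym2 V)} {z : V} {μ : Measure (ℕ → V)}

/-- Horizontal displacement of a trajectory with the accumulated drift subtracted. -/
def compensated (β : ℝ) (G : Set (Sym2 V)) (n : ℕ) (ω : ℕ → V) : ℝ :=
  ((ω n).1 : ℝ) - (ω 0).1 - ∑ i ∈ Finset.range n, drift β G (ω i)

lemma compensated_succ (n : ℕ) (ω : ℕ → V) :
    compensated β G (n + 1) ω = compensated β G n ω +
      (((ω (n + 1)).1 : ℝ) - (ω n).1 - drift β G (ω n)) := by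
  simp only [compensated, Finset.sum_range_succ]; ring

lemma measurable_compensated (n : ℕ) : Measurable (compensated β G n) := by
  have h : ∀ (f : V → ℝ) (i : ℕ), Measurable fun ω : ℕ → V => f (ω i) := fun f i =>
    (Measurable.of_discrete (f := f)).comp (measurable_pi_apply i)
  unfold compensated
  exact ((h (fun v => (v.1 : ℝ)) n).sub (h (fun v => (v.1 : ℝ)) 0)).sub
    (Finset.measurable_sum _ fun i _ => h _ i)

lemma IsWalkLaw.lintegral_compensated_sq_le (hμ : IsWalkLaw β G z μ) (hβ : 1 < β)
    (hG : IsLatticeGraph G) (n : ℕ) :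
    ∫⁻ ω, ENNReal.ofReal (compensated β G n ω ^ 2) ∂μ ≤ 4 * n := by
  have := hμ.1
  induction n with
  | zero => simp [compensated]
  | succ n ih =>
    set A : (Fin (n + 1) → V) → ℝ := fun g => ((g (Fin.last n)).1 : ℝ) - (g 0).1 -
      ∑ i : Fin n, drift β G (g i.castSucc) with hA
    have hAh : ∀ ω, A (history n ω) = compensated β G n ω := by
      intro ω
      simp only [hA, history, compensated, Fin.val_last, Fin.val_castSucc, Fin.val_zero]
      rw [Fin.sum_univ_eq_sum_range (fun i => drift β G (ω i))]
    have h := hμ.lintegral_step hβ hG n fun g w => ENNReal.ofReal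
      ((A g + ((w.1 : ℝ) - (g (Fin.last n)).1 - drift β G (g (Fin.last n)))) ^ 2)
    have h2 : ∀ ω : ℕ → V, history n ω (Fin.last n) = ω n := fun ω => rfl
    simp only [h2, hAh, ← compensated_succ] at h
    rw [h]
    calc _ ≤ ∫⁻ ω, (ENNReal.ofReal (compensated β G n ω ^ 2) + 4) ∂μ := by
          refine lintegral_mono fun ω => ?_
          simp only
          rw [show (4 : ℝ≥0∞) = ENNReal.ofReal 4 by norm_num,
            ← ENNReal.ofReal_add (sq_nonneg _) (by norm_num)]
          refine le_trans (le_of_eq ?_)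
            (ENNReal.ofReal_le_ofReal (sum_transProb_mul_sq_le hβ hG (ω n) _))
          rw [ENNReal.ofReal_sum_of_nonneg]
          · refine Finset.sum_congr rfl fun w _ => ?_
            rw [ENNReal.ofReal_mul (transProb_nonneg hβ hG _ _)]
          · intro w _
            exact mul_nonneg (transProb_nonneg hβ hG _ _) (sq_nonneg _)
      _ ≤ 4 * n + 4 := by
          rw [lintegral_add_right _ measurable_const, lintegral_const, measure_univ, mul_one]
          gcongr
      _ = _ := by push_cast; ring

/-- If the expectations of nonnegative functions are summable, the functions tend to zero almost
everywhere. -/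
lemma ae_tendsto_zero_of_lintegral_le {Ω : Type*} [MeasurableSpace Ω] {ν : Measure Ω}
    {f : ℕ → Ω → ℝ} (hf : ∀ n, Measurable (f n)) (h0 : ∀ n ω, 0 ≤ f n ω) {a : ℕ → ℝ}
    (ha : Summable a) (ha0 : ∀ n, 0 ≤ a n)
    (h : ∀ n, ∫⁻ ω, ENNReal.ofReal (f n ω) ∂ν ≤ ENNReal.ofReal (a n)) :
    ∀ᵐ ω ∂ν, Tendsto (fun n => f n ω) atTop (nhds 0) := by
  have hsum : ∫⁻ ω, ∑' n, ENNReal.ofReal (f n ω) ∂ν ≠ ∞ := by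
    rw [lintegral_tsum fun n => (hf n).ennreal_ofReal.aemeasurable]
    refine ne_top_of_le_ne_top ?_ (ENNReal.tsum_le_tsum h)
    rw [← ENNReal.ofReal_tsum_of_nonneg ha0 ha]
    exact ENNReal.ofReal_ne_top
  filter_upwards [ae_lt_top' (by fun_prop) hsum] with ω hω
  have ht := ENNReal.tendsto_atTop_zero_of_tsum_ne_top hω.ne
  have := (ENNReal.tendsto_toReal ENNReal.zero_ne_top).comp ht
  simpa [Function.comp_def, ENNReal.toReal_ofReal (h0 _ ω)] using this

lemma IsWalkLaw.ae_tendsto_compensated_sq (hμ : IsWalkLaw β G z μ) (hβ : 1 < β)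
    (hG : IsLatticeGraph G) :
    ∀ᵐ ω ∂μ, Tendsto (fun n : ℕ => compensated β G (n ^ 2) ω / (n : ℝ) ^ 2) atTop (nhds 0) := by
  have hs : Summable fun n : ℕ => 4 * (1 / (n : ℝ) ^ 2) :=
    (Real.summable_one_div_nat_pow.2 one_lt_two).mul_left 4
  have h := ae_tendsto_zero_of_lintegral_le (ν := μ)
    (f := fun n ω => (compensated β G (n ^ 2) ω / (n : ℝ) ^ 2) ^ 2)
    (fun n => ((measurable_compensated _).div_const _).pow_const 2)
    (fun n ω => sq_nonneg _) hs (fun n => by positivity) (fun n => ?_)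
  · filter_upwards [h] with ω hω
    have := hω.sqrt
    simp only [Real.sqrt_zero, Real.sqrt_sq_eq_abs] at this
    exact (tendsto_zero_iff_abs_tendsto_zero _).2 this
  · rcases Nat.eq_zero_or_pos n with rfl | hn
    · simp
    have hn' : (0 : ℝ) < n := by exact_mod_cast hn
    calc ∫⁻ ω, ENNReal.ofReal ((compensated β G (n ^ 2) ω / (n : ℝ) ^ 2) ^ 2) ∂μ
        = ∫⁻ ω, ENNReal.ofReal (compensated β G (n ^ 2) ω ^ 2) *
            ENNReal.ofReal (1 / (n : ℝ) ^ 4) ∂μ := by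
          refine lintegral_congr fun ω => ?_
          rw [← ENNReal.ofReal_mul (sq_nonneg _)]
          congr 1
          field_simp
      _ = (∫⁻ ω, ENNReal.ofReal (compensated β G (n ^ 2) ω ^ 2) ∂μ) *
            ENNReal.ofReal (1 / (n : ℝ) ^ 4) :=
          lintegral_mul_const' _ _ ENNReal.ofReal_ne_top
      _ ≤ (4 * (n ^ 2 : ℕ)) * ENNReal.ofReal (1 / (n : ℝ) ^ 4) := by
          gcongr
          exact hμ.lintegral_compensated_sq_le hβ hG _
      _ = ENNReal.ofReal (4 * (1 / (n : ℝ) ^ 2)) := by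
          rw [show (4 * ((n ^ 2 : ℕ) : ℝ≥0∞)) = ENNReal.ofReal (4 * (n : ℝ) ^ 2) by
            rw [ENNReal.ofReal_mul (by norm_num)]
            norm_num]
          rw [← ENNReal.ofReal_mul (by positivity)]
          congr 1
          field_simp

lemma tendsto_div_of_tendsto_sq {f : ℕ → ℝ} {C : ℝ} (hstep : ∀ n, |f (n + 1) - f n| ≤ C)
    (h : Tendsto (fun n : ℕ => f (n ^ 2) / (n : ℝ) ^ 2) atTop (nhds 0)) :
    Tendsto (fun n : ℕ => f n / n) atTop (nhds 0) := by
  have hC : 0 ≤ C := (abs_nonneg _).trans (hstep 0)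
  have hlip : ∀ m k, |f (m + k) - f m| ≤ C * k := by
    intro m k
    induction k with
    | zero => simp
    | succ k ih =>
      calc |f (m + (k + 1)) - f m| = |(f (m + k + 1) - f (m + k)) + (f (m + k) - f m)| := by
            congr 1; rw [← add_assoc]; ring
        _ ≤ C + C * k := (abs_add_le _ _).trans (add_le_add (hstep _) ih)
        _ = _ := by push_cast; ring
  have hsqrt : Tendsto Nat.sqrt atTop atTop := by
    refine tendsto_atTop_mono' atTop (f₁ := fun n => Nat.sqrt n) (by rfl) ?_
    refine tendsto_atTop.2 fun b => ?_
    filter_upwards [eventually_ge_atTop (b * b)] with n hn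
    exact Nat.le_sqrt.2 hn
  have hb : Tendsto (fun n : ℕ => |f (n ^ 2) / (n : ℝ) ^ 2| + 2 * C / n) atTop (nhds 0) := by
    have h1 := h.abs
    have h2 : Tendsto (fun n : ℕ => 2 * C / (n : ℝ)) atTop (nhds 0) :=
      tendsto_const_div_atTop_nhds_zero_nat _
    simpa using h1.add h2
  refine squeeze_zero_norm' ?_ (hb.comp hsqrt)
  filter_upwards [eventually_ge_atTop 1] with n hn
  set m := Nat.sqrt n with hm
  have hm1 : 1 ≤ m := Nat.le_sqrt.2 (by omega)
  have hmn : m ^ 2 ≤ n := by rw [pow_two]; exact Nat.sqrt_le n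
  have hnm : n ≤ m ^ 2 + 2 * m := by
    have h1 := Nat.sqrt_le_add n
    have h2 : m ^ 2 = n.sqrt * n.sqrt := by rw [hm, pow_two]
    omega
  obtain ⟨k, hk⟩ := Nat.exists_eq_add_of_le hmn
  have hk2 : (k : ℝ) ≤ 2 * m := by exact_mod_cast (by omega : k ≤ 2 * m)
  have hm0 : (0 : ℝ) < m := by exact_mod_cast hm1
  have hn0 : (0 : ℝ) < n := by exact_mod_cast hn
  have hmn' : (m : ℝ) ^ 2 ≤ n := by exact_mod_cast hmn
  have hfn : |f n| ≤ |f (m ^ 2)| + C * (2 * m) := by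
    have h1 := hlip (m ^ 2) k
    rw [← hk] at h1
    have h2 : C * k ≤ C * (2 * m) := mul_le_mul_of_nonneg_left hk2 hC
    have h3 : |f n| ≤ |f n - f (m ^ 2)| + |f (m ^ 2)| := by
      have := abs_add_le (f n - f (m ^ 2)) (f (m ^ 2))
      rwa [sub_add_cancel] at this
    linarith
  simp only [Function.comp_apply, Real.norm_eq_abs, ← hm]
  rw [abs_div, abs_div, abs_of_pos hn0, abs_of_pos (by positivity : (0 : ℝ) < (m : ℝ) ^ 2)]
  calc |f n| / n ≤ (|f (m ^ 2)| + C * (2 * m)) / n := by gcongr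
    _ ≤ (|f (m ^ 2)| + C * (2 * m)) / (m : ℝ) ^ 2 := by gcongr
    _ = _ := by
      rw [add_div]
      congr 1
      field_simp

lemma IsWalkLaw.ae_tendsto_compensated (hμ : IsWalkLaw β G z μ) (hβ : 1 < β)
    (hG : IsLatticeGraph G) :
    ∀ᵐ ω ∂μ, Tendsto (fun n : ℕ => compensated β G n ω / n) atTop (nhds 0) := by
  filter_upwards [hμ.ae_tendsto_compensated_sq hβ hG, hμ.ae_transProb_ne_zero hβ hG]
    with ω h hω
  refine tendsto_div_of_tendsto_sq (C := 2) (fun n => ?_) h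
  rw [compensated_succ, add_sub_cancel_left]
  have hmem : ω (n + 1) ∈ insert (ω n) (nbrs (ω n)) := by
    by_contra hc
    exact hω n (transProb_eq_zero hβ hG hc)
  have h1 := abs_le.1 (abs_sub_le_one_of_mem hmem)
  have h2 := abs_le.1 (abs_drift_le_one hβ hG (ω n))
  rw [abs_le]
  constructor <;> linarith

open scoped Classical in
/-- Number of times before `t` at which the trajectory is at a vertex that is not flat. -/
def nonflatCount (G : Set (Sym2 V)) (t : ℕ) (ω : ℕ → V) : ℝ :=
  ∑ n ∈ Finset.range t, if IsFlat G (ω n) then 0 else 1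

lemma nonflatCount_nonneg (t : ℕ) (ω : ℕ → V) : 0 ≤ nonflatCount G t ω :=
  Finset.sum_nonneg fun _ _ => by split_ifs <;> simp

lemma nonflatCount_mono (ω : ℕ → V) {s t : ℕ} (h : s ≤ t) :
    nonflatCount G s ω ≤ nonflatCount G t ω :=
  Finset.sum_le_sum_of_subset_of_nonneg (Finset.range_mono h) fun _ _ _ => by
    split_ifs <;> simp

lemma measurable_nonflatCount (t : ℕ) : Measurable (nonflatCount G t) := by
  classical
  unfold nonflatCount
  refine Finset.measurable_sum _ fun i _ => ?_
  exact (Measurable.of_discrete (f := fun v : V => if IsFlat G v then (0 : ℝ) else 1)).comp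
    (measurable_pi_apply i)

/-- The walk has speed `(β - 1) / (β + 1)` as soon as it spends a vanishing proportion of its
time at non-flat vertices. -/
lemma IsWalkLaw.ae_speed_of_nonflatCount (hμ : IsWalkLaw β G z μ) (hβ : 1 < β)
    (hG : IsLatticeGraph G)
    (h : ∀ᵐ ω ∂μ, Tendsto (fun t : ℕ => nonflatCount G t ω / t) atTop (nhds 0)) :
    ∀ᵐ ω ∂μ, Tendsto (fun t : ℕ => ((ω t).1 : ℝ) / t) atTop
      (nhds ((β - 1) / (β + 1))) := by
  filter_upwards [h, hμ.ae_tendsto_compensated hβ hG] with ω h1 h2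
  set s : ℝ := (β - 1) / (β + 1) with hs
  have hs1 : |s| ≤ 1 := by
    rw [hs, abs_le]
    have : 0 < β + 1 := by linarith
    constructor
    · rw [le_div_iff₀ this]; linarith
    · rw [div_le_iff₀ this]; linarith
  have hD : ∀ t : ℕ, |∑ i ∈ Finset.range t, (drift β G (ω i) - s)| ≤ 2 * nonflatCount G t ω := by
    intro t
    rw [nonflatCount, Finset.mul_sum]
    refine (Finset.abs_sum_le_sum_abs _ _).trans (Finset.sum_le_sum fun i _ => ?_)
    split_ifs with hf
    · rw [drift_of_isFlat hβ hG hf]; simp [hs]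
    · have h3 := abs_le.1 (abs_drift_le_one hβ hG (ω i))
      have h4 := abs_le.1 hs1
      rw [abs_le]; constructor <;> linarith
  have h3 : Tendsto (fun t : ℕ => (∑ i ∈ Finset.range t, (drift β G (ω i) - s)) / t) atTop
      (nhds 0) := by
    have h1' := h1.const_mul 2
    rw [mul_zero] at h1'
    refine squeeze_zero_norm (fun t => ?_) h1'
    rw [Real.norm_eq_abs, abs_div, Nat.abs_cast, ← mul_div_assoc]
    exact div_le_div_of_nonneg_right (hD t) (Nat.cast_nonneg t)
  have h4 : Tendsto (fun t : ℕ => ((ω 0).1 : ℝ) / t) atTop (nhds 0) :=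
    tendsto_const_div_atTop_nhds_zero_nat _
  have h5 := ((h2.add h3).add h4).add_const s
  simp only [zero_add] at h5
  refine h5.congr' ?_
  filter_upwards [eventually_ge_atTop 1] with t ht
  have ht0 : (t : ℝ) ≠ 0 := by positivity
  simp only [compensated, Finset.sum_sub_distrib, Finset.sum_const, Finset.card_range,
    nsmul_eq_mul]
  field_simp
  ring

lemma tendsto_div_of_tendsto_div_strictMono {f : ℕ → ℝ} (hf0 : ∀ n, 0 ≤ f n) (hf : Monotone f)
    {T : ℕ → ℕ} (hT : StrictMono T) (hT0 : 0 < T 0)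
    (h : Tendsto (fun K => f (T (K + 1)) / T K) atTop (nhds 0)) :
    Tendsto (fun n : ℕ => f n / n) atTop (nhds 0) := by
  rw [Metric.tendsto_atTop] at h ⊢
  intro ε hε
  obtain ⟨K₀, hK₀⟩ := h ε hε
  refine ⟨T K₀, fun n hn => ?_⟩
  have hKn : K₀ ≤ n := hT.le_apply.trans hn
  set K := Nat.findGreatest (fun K => T K ≤ n) n with hK
  have h1 : T K ≤ n := Nat.findGreatest_spec (P := fun K => T K ≤ n) hKn hn
  have h2 : K₀ ≤ K := Nat.le_findGreatest hKn hn
  have h3 : n < T (K + 1) := by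
    by_contra hc
    push Not at hc
    have := Nat.le_findGreatest (P := fun K => T K ≤ n) (hT.le_apply.trans hc) hc
    omega
  have hTK : (0 : ℝ) < T K := by
    exact_mod_cast hT0.trans_le (hT.monotone (Nat.zero_le K))
  have h4 := hK₀ K h2
  rw [Real.dist_eq, sub_zero, abs_of_nonneg (div_nonneg (hf0 _) (Nat.cast_nonneg _))] at h4 ⊢
  refine lt_of_le_of_lt ?_ h4
  have h1' : (T K : ℝ) ≤ n := by exact_mod_cast h1
  exact div_le_div₀ (hf0 _) (hf h3.le) hTK h1'

/-- Criterion for the speed: along a sequence of times `T`, the non-flat vertices visited before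
time `T (K + 1)` lie in a finite set `B K` whose total expected number of visits, estimated by a
superharmonic function `u`, is summable relative to `T K`. -/
theorem IsWalkLaw.ae_speed_of_superharmonic (hμ : IsWalkLaw β G z μ) (hβ : 1 < β)
    (hG : IsLatticeGraph G) (hz : ∃ u, s(z, u) ∈ G)
    (Q : Set V) (hQ : ∀ v ∈ Q, ∀ w, s(v, w) ∈ G → w ∈ Q)
    (u : V → ℝ) (hu0 : ∀ v ∈ Q, 0 ≤ u v)
    (hu : ∀ v ∈ Q, (∃ w, s(v, w) ∈ G) →
      ∑ w ∈ nbrs v, conductance β G v w * u w + (if v = z then 1 else 0) ≤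
        totalCond β G v * u v)
    {T : ℕ → ℕ} (hT : StrictMono T) (hT0 : 0 < T 0) (B : ℕ → Finset V)
    (hBQ : ∀ K, ∀ v ∈ B K, v ∈ Q)
    (hB : ∀ ω : ℕ → V, ω 0 = z → (∀ n, s(ω n, ω (n + 1)) ∈ G) →
      ∀ K, ∀ n < T (K + 1), ¬ IsFlat G (ω n) → ω n ∈ B K)
    {a : ℕ → ℝ} (ha : ∀ K, ∑ v ∈ B K, totalCond β G v * u v ≤ a K)
    (hsum : Summable fun K => a K / T K) :
    ∀ᵐ ω ∂μ, Tendsto (fun t : ℕ => ((ω t).1 : ℝ) / t) atTop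
      (nhds ((β - 1) / (β + 1))) := by
  classical
  have := hμ.1
  refine hμ.ae_speed_of_nonflatCount hβ hG ?_
  have ha0 : ∀ K, 0 ≤ a K := fun K => le_trans (Finset.sum_nonneg fun v hv =>
    mul_nonneg (totalCond_nonneg hβ v) (hu0 v (hBQ K v hv))) (ha K)
  have hE : ∀ K, ∫⁻ ω, ENNReal.ofReal (nonflatCount G (T (K + 1)) ω) ∂μ ≤
      ENNReal.ofReal (a K) := by
    intro K
    calc ∫⁻ ω, ENNReal.ofReal (nonflatCount G (T (K + 1)) ω) ∂μ
        ≤ ∫⁻ ω, ∑ v ∈ B K, ∑ n ∈ Finset.range (T (K + 1)),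
            {ω : ℕ → V | ω n = v}.indicator 1 ω ∂μ := by
          refine lintegral_mono_ae ?_
          filter_upwards [hμ.ae_path hβ hG hz] with ω hω
          rw [Finset.sum_comm, nonflatCount, ENNReal.ofReal_sum_of_nonneg
            fun _ _ => by split_ifs <;> simp]
          refine Finset.sum_le_sum fun n hn => ?_
          split_ifs with hf
          · simp
          · rw [ENNReal.ofReal_one]
            have hmem := hB ω hω.1 hω.2 K n (Finset.mem_range.1 hn) hf
            refine le_trans (le_of_eq ?_) (Finset.single_le_sum (fun _ _ => zero_le) hmem)
            simp
      _ = ENNReal.ofReal (∑ v ∈ B K, ∑ n ∈ Finset.range (T (K + 1)),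
            μ.real {ω : ℕ → V | ω n = v}) := by
          rw [lintegral_finsetSum _ fun v _ => Finset.measurable_sum _ fun n _ =>
            measurable_one.indicator (measurableSet_visit n v), ENNReal.ofReal_sum_of_nonneg
            fun _ _ => Finset.sum_nonneg fun _ _ => measureReal_nonneg]
          refine Finset.sum_congr rfl fun v _ => ?_
          rw [lintegral_finsetSum _ fun n _ =>
            measurable_one.indicator (measurableSet_visit n v), ENNReal.ofReal_sum_of_nonneg
            fun _ _ => measureReal_nonneg]
          refine Finset.sum_congr rfl fun n _ => ?_
          rw [lintegral_indicator_one (measurableSet_visit n v), ofReal_measureReal]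
      _ ≤ ENNReal.ofReal (a K) := by
          refine ENNReal.ofReal_le_ofReal (le_trans (Finset.sum_le_sum fun v hv => ?_) (ha K))
          exact hμ.sum_visit_le hβ hG hz Q hQ u hu0 hu _ v (hBQ K v hv)
  have h := ae_tendsto_zero_of_lintegral_le (ν := μ)
    (f := fun K ω => nonflatCount G (T (K + 1)) ω / T K)
    (fun K => (measurable_nonflatCount _).div_const _)
    (fun K ω => div_nonneg (nonflatCount_nonneg _ _) (Nat.cast_nonneg _)) hsum
    (fun K => div_nonneg (ha0 K) (Nat.cast_nonneg _)) (fun K => ?_)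
  · filter_upwards [h] with ω hω
    exact tendsto_div_of_tendsto_div_strictMono (fun n => nonflatCount_nonneg n ω)
      (fun _ _ h => nonflatCount_mono ω h) hT hT0 hω
  · simp only [div_eq_mul_inv]
    simp_rw [ENNReal.ofReal_mul (nonflatCount_nonneg _ _)]
    rw [lintegral_mul_const' _ _ ENNReal.ofReal_ne_top, ENNReal.ofReal_mul (ha0 K)]
    gcongr
    exact hE K

end

lemma bF_succ (k : ℕ) : bF (k + 1) = 3 ^ k * bF k := by
  unfold bF
  rw [Nat.triangle_succ, pow_add]
  ring

lemma bF_pos (k : ℕ) : 0 < bF k := by unfold bF; positivity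

lemma bF_dvd_bF {m n : ℕ} (h : m ≤ n) : bF m ∣ bF n := by
  induction n, h using Nat.le_induction with
  | base => exact dvd_rfl
  | succ n _ ih => exact ih.trans (bF_succ n ▸ Dvd.intro_left _ rfl)

lemma bF_mono : Monotone bF := fun _ n h => Nat.le_of_dvd (bF_pos n) (bF_dvd_bF h)

lemma three_mul_bF_le {k : ℕ} (hk : 1 ≤ k) : 3 * bF k ≤ bF (k + 1) := by
  rw [bF_succ]
  exact Nat.mul_le_mul_right _ (Nat.le_self_pow (by omega) 3)

lemma bF_pred_eq {k : ℕ} : bF (k - 1) = 4 * cF k := by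
  unfold bF cF; rfl

lemma IsTip.dvd {m : ℕ} {x : ℤ} (h : IsTip m x) : (bF m : ℤ) ∣ x := by
  induction h with
  | zero k => exact dvd_zero _
  | step k x j _ _ _ ih =>
    refine dvd_add (dvd_trans ?_ ih) (Dvd.intro_left _ rfl)
    exact_mod_cast bF_dvd_bF (Nat.le_succ k)

lemma IsTip.nonneg {m : ℕ} {x : ℤ} (h : IsTip m x) : 0 ≤ x := by
  induction h with
  | zero k => exact le_rfl
  | step k x j _ hj _ ih =>
    have : (0 : ℤ) ≤ (j : ℤ) - 1 := by omega
    positivity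

/-- The columns of a branch of order `m` avoid the last `b_r` columns of every block of length
`b_{r+1}`, for `r ≥ m`. -/
lemma IsTip.emod_add_lt {m : ℕ} {x : ℤ} (h : IsTip m x) (hm : 1 ≤ m) {r : ℕ} (hr : m ≤ r)
    {a : ℤ} (h1 : x ≤ a) (h2 : a < x + bF m) :
    a % (bF (r + 1) : ℤ) + bF r < bF (r + 1) := by
  induction h generalizing a with
  | zero k =>
    have h3 : (3 * bF r : ℤ) ≤ bF (r + 1) := by exact_mod_cast three_mul_bF_le (hm.trans hr)
    have h4 : (bF k : ℤ) ≤ bF r := by exact_mod_cast bF_mono hr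
    have h5 : (0 : ℤ) < bF k := by exact_mod_cast bF_pos k
    rw [Int.emod_eq_of_lt h1 (by linarith)]
    linarith
  | step k x j hx hj hjq ih =>
    have hq : ((j : ℤ) + 1) ≤ 3 ^ k := by
      have : 0 < 3 ^ k := by positivity
      unfold qF at hjq
      exact_mod_cast (by omega : j + 1 ≤ 3 ^ k)
    have hb : (0 : ℤ) < bF k := by exact_mod_cast bF_pos k
    have hs : (bF (k + 1) : ℤ) = 3 ^ k * bF k := by exact_mod_cast bF_succ k
    have h0 : 0 ≤ ((j : ℤ) - 1) * bF k := mul_nonneg (by omega) hb.le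
    have h5 : ((j : ℤ) + 1) * bF k ≤ 3 ^ k * bF k := mul_le_mul_of_nonneg_right hq hb.le
    rcases hr.eq_or_lt with rfl | hlt
    · obtain ⟨t, ht⟩ := hx.dvd
      have h6 : a % (bF (k + 1) : ℤ) = a - x := by
        rw [show a = (a - x) + (bF (k + 1) : ℤ) * t by rw [← ht]; ring, Int.add_mul_emod_self_left,
          Int.emod_eq_of_lt (by linarith) (by linarith)]
        rw [← ht]; ring
      rw [h6]
      linarith
    · exact ih (by omega) hlt (by linarith) (by linarith)

lemma dirF_eq (l : ℤ) : dirF l = 1 ∨ dirF l = -1 := by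
  unfold dirF; split_ifs <;> simp

lemma exists_odd_of_dirF {l : ℤ} (hl : Odd l) : ∃ j, Odd j ∧ l + dirF l = 2 * j := by
  obtain ⟨q, rfl⟩ := hl
  have h : (2 * q + 1 + 1) / 2 = q + 1 := by omega
  unfold dirF
  rw [h]
  split_ifs with hq
  · exact ⟨q + 1, hq, by ring⟩
  · refine ⟨q, ?_, by ring⟩
    rw [Int.not_odd_iff_even, Int.even_add_one, Int.not_even_iff_odd] at hq
    exact hq

lemma abutment_row_eq {g l j A : ℤ} (hg : 0 < g) (hl : Odd l) (h0 : 0 ≤ j) (h1 : j ≤ g)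
    (h : g * l + dirF l * j = 2 * g * A) : j = g ∧ Odd A := by
  obtain ⟨j₀, hj₀, hd⟩ := exists_odd_of_dirF hl
  have ht : g * (2 * A - l) = dirF l * j := by linarith
  obtain ⟨q, rfl⟩ := hl
  rcases dirF_eq (2 * q + 1) with hdir | hdir <;> rw [hdir] at ht hd
  · have h2 : 2 * A - (2 * q + 1) ≤ 1 := by nlinarith
    have h3 : 0 ≤ 2 * A - (2 * q + 1) := by nlinarith
    have h4 : 2 * A - (2 * q + 1) = 1 := by omega
    rw [h4] at ht
    exact ⟨by linarith, by rwa [show A = j₀ by omega]⟩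
  · have h2 : -1 ≤ 2 * A - (2 * q + 1) := by nlinarith
    have h3 : 2 * A - (2 * q + 1) ≤ 0 := by nlinarith
    have h4 : 2 * A - (2 * q + 1) = -1 := by omega
    rw [h4] at ht
    exact ⟨by linarith, by rwa [show A = j₀ by omega]⟩

lemma row_add_ne {g l i A : ℤ} (hl : Odd l) (h0 : 0 ≤ i) (h1 : i < g) :
    g * l + i ≠ 2 * g * A := by
  intro h
  obtain ⟨q, rfl⟩ := hl
  have ht : g * (2 * A - (2 * q + 1)) = i := by linarith
  have h2 : 2 * A - (2 * q + 1) < 1 := by nlinarith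
  have h3 : 0 ≤ 2 * A - (2 * q + 1) := by nlinarith
  omega

lemma eq_of_abs_row_sub_lt {g l l' o : ℤ} (hl : Odd l) (hl' : Odd l') (ho : |o| ≤ g)
    (h : |g * l' + o - g * l| < g) : l' = l := by
  obtain ⟨q, rfl⟩ := hl
  obtain ⟨q', rfl⟩ := hl'
  rw [abs_lt] at h
  rw [abs_le] at ho
  have h1 : q' - q < 1 := by nlinarith
  have h2 : -1 < q' - q := by nlinarith
  omega

lemma block_subset {b x a Y N : ℤ} (hb : 0 < b) (hx : b ∣ x) (hY : b ∣ Y) (hN : b ∣ N)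
    (h1 : x ≤ a) (h2 : a < x + b) (h3 : Y ≤ a) (h4 : a < Y + N) : Y ≤ x ∧ x + b ≤ Y + N := by
  obtain ⟨p, rfl⟩ := hx
  obtain ⟨q, rfl⟩ := hY
  obtain ⟨n, rfl⟩ := hN
  have h5 : q < p + 1 := by nlinarith
  have h6 : p < q + n := by nlinarith
  constructor <;> nlinarith

/-- The edge from `p` to `q` belongs to the main part of the branch, or to its abutment. -/
def BranchEdge (m : ℕ) (l x : ℤ) (p q : V) : Prop :=
  (p.2 = rowY m l ∧ q.2 = rowY m l ∧ q.1 = p.1 + 1 ∧ x ≤ p.1 ∧ p.1 + 1 < x + bF m) ∨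
  (p.1 = x + bF m - 1 ∧ q.1 = x + bF m - 1 ∧ ∃ j : ℤ, 0 ≤ j ∧ j < 3 * 2 ^ (m - 1) ∧
    p.2 = rowY m l + dirF l * j ∧ q.2 = rowY m l + dirF l * (j + 1))

/-- The edge from `p` to `q` is a lattice edge in the region occupied by the trap of the
branch. -/
def TrapEdge (m : ℕ) (l x : ℤ) (p q : V) : Prop :=
  (x + bF m - bF (m - 1) ≤ p.1 ∧ p.1 < x + bF m - 1) ∧
  (x + bF m - bF (m - 1) ≤ q.1 ∧ q.1 < x + bF m - 1) ∧
  ((q.1 = p.1 ∧ q.2 = p.2 + 1 ∧ (p.2 = rowY m l ∨ p.2 = rowY m l + 1)) ∨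
    (q.1 = p.1 + 1 ∧ q.2 = p.2 ∧ (p.2 = rowY m l + 1 ∨ p.2 = rowY m l + 2)))

lemma trapEdge_of_mem {γ : ℝ} {m : ℕ} {l x : ℤ} {v w : V}
    (h : s(v, w) ∈ branchTrap γ m l x) : TrapEdge m l x v w ∨ TrapEdge m l x w v := by
  have he : (eF γ m : ℤ) ≤ cF m := by exact_mod_cast min_le_right _ _
  have hc : (0 : ℤ) < cF m := by exact_mod_cast (by unfold cF; positivity : 0 < cF m)
  have hb : (bF (m - 1) : ℤ) = 4 * cF m := by exact_mod_cast bF_pred_eq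
  unfold TrapEdge
  unfold branchTrap trapEdgesAt anchorX at h
  rw [hb]
  simp only [Set.mem_union, Set.mem_insert_iff, Set.mem_singleton_iff, Set.mem_ofPred_eq,
    Sym2.eq_iff, Prod.ext_iff] at h
  rcases h with ((h | h) | ⟨i, hi, h⟩) | ⟨i, hi, h⟩
  all_goals rcases h with ⟨⟨h1, h2⟩, h3, h4⟩ | ⟨⟨h1, h2⟩, h3, h4⟩
  all_goals rw [h1, h2, h3, h4]
  all_goals omega

lemma branchEdge_of_mem {v w : V} (h : s(v, w) ∈ xiEdges) :
    ∃ (m : ℕ) (l x : ℤ), 1 ≤ m ∧ Odd l ∧ IsTip m x ∧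
      (BranchEdge m l x v w ∨ BranchEdge m l x w v) := by
  obtain ⟨m, l, x, hm, hl, hx, h⟩ := h
  refine ⟨m, l, x, hm, hl, hx, ?_⟩
  unfold BranchEdge
  rcases h with ⟨i, hi, h⟩ | ⟨j, hj, h⟩
  · have hi' : (i : ℤ) + 2 ≤ bF m := by exact_mod_cast hi
    simp only [Sym2.eq_iff, Prod.ext_iff] at h
    rcases h with ⟨⟨h1, h2⟩, h3, h4⟩ | ⟨⟨h1, h2⟩, h3, h4⟩
    · left; left; omega
    · right; left; omega
  · have hj' : (j : ℤ) < 3 * 2 ^ (m - 1) := by exact_mod_cast hj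
    simp only [Sym2.eq_iff, Prod.ext_iff] at h
    rcases h with ⟨⟨h1, h2⟩, h3, h4⟩ | ⟨⟨h1, h2⟩, h3, h4⟩
    · left; right; exact ⟨h1, h3, j, by omega, hj', h2, h4⟩
    · right; right; exact ⟨h3, h1, j, by omega, hj', h4, h2⟩

lemma BranchEdge.mem_nbrs {m : ℕ} {l x : ℤ} {p q : V} (h : BranchEdge m l x p q) :
    q ∈ nbrs p ∧ p ∈ nbrs q := by
  simp only [_root_.mem_nbrs, Prod.ext_iff]
  rcases h with h | ⟨h1, h2, j, -, -, h3, h4⟩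
  · omega
  · rcases dirF_eq l with hd | hd <;> rw [hd] at h3 h4 <;> omega

lemma TrapEdge.mem_nbrs {m : ℕ} {l x : ℤ} {p q : V} (h : TrapEdge m l x p q) :
    q ∈ nbrs p ∧ p ∈ nbrs q := by
  simp only [_root_.mem_nbrs, Prod.ext_iff]
  obtain ⟨-, -, h⟩ := h
  omega

lemma isLatticeGraph_etaEdges (γ : ℝ) : IsLatticeGraph (etaEdges γ) := by
  rintro v w (h | ⟨m, l, x, -, -, -, h⟩)
  · obtain ⟨m, l, x, -, -, -, h | h⟩ := branchEdge_of_mem h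
    exacts [h.mem_nbrs.1, h.mem_nbrs.2]
  · rcases trapEdge_of_mem h with h | h
    exacts [h.mem_nbrs.1, h.mem_nbrs.2]

/-- A vertex `z` on the main part of an order-1 branch, and the chain of branches traversed by the
infinite path from `z`. -/
structure IsSpine (L X : ℕ → ℤ) (z : V) : Prop where
  odd_one : Odd (L 1)
  tip_one : IsTip 1 (X 1)
  chain : IsBranchChain L X
  start : OnMainPart 1 (L 1) (X 1) z

/-- The configuration obtained from `etaEdges γ` by removing the traps of the chain. -/
def prunedEdges (γ : ℝ) (L X : ℕ → ℤ) : Set (Sym2 V) :=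
  etaEdges γ \ {f | ∃ k : ℕ, 2 ≤ k ∧ f ∈ branchTrap γ k (L k) (X k)}

/-- Row of the main part of the branch of order `s + 1` of the chain. -/
def spineRow (L : ℕ → ℤ) (s : ℕ) : ℤ := 3 * 2 ^ s * L (s + 1)

/-- Column of the abutment of the branch of order `s + 1` of the chain. -/
def cornerCol (X : ℕ → ℤ) (s : ℕ) : ℤ := X (s + 1) + bF (s + 1) - 1

/-- Column at which the path from `z` enters the branch of order `s + 1` of the chain. -/
def entryCol (X : ℕ → ℤ) (z : V) : ℕ → ℤ
  | 0 => z.1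
  | s + 1 => cornerCol X s

/-- The box bounded by the branch of order `s + 1` of the chain. -/
def stageBox (L X : ℕ → ℤ) (s : ℕ) : Set V :=
  {v | X (s + 1) ≤ v.1 ∧ v.1 ≤ cornerCol X s ∧ |v.2 - spineRow L s| < 3 * 2 ^ s}

/-- The possible edges of the configuration with an endpoint in the box of stage `s`: edges of the
main part, edges of the abutment, and edges inside a bush hanging from the main part. -/
def LocalEdge (L X : ℕ → ℤ) (s : ℕ) (p q : V) : Prop :=
  (p.2 = spineRow L s ∧ q.2 = spineRow L s ∧ p ∈ stageBox L X s ∧ q ∈ stageBox L X s ∧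
    q.1 = p.1 + 1) ∨
  (p.1 = cornerCol X s ∧ q.1 = cornerCol X s ∧ ∃ j : ℤ, 0 ≤ j ∧ j < 3 * 2 ^ s ∧
    p.2 = spineRow L s + dirF (L (s + 1)) * j ∧
    q.2 = spineRow L s + dirF (L (s + 1)) * (j + 1)) ∨
  (p ∈ stageBox L X s ∧ q ∈ stageBox L X s ∧ p.1 ≠ cornerCol X s ∧ q.1 ≠ cornerCol X s ∧
    p.1 / bF s = q.1 / bF s ∧
    (p.2 = spineRow L s ∨ q.2 = spineRow L s → p.1 = q.1 ∧ (bF s : ℤ) ∣ p.1 + 1))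

namespace IsSpine

variable {L X : ℕ → ℤ} {z : V} {γ : ℝ}

lemma odd (h : IsSpine L X z) (s : ℕ) : Odd (L (s + 1)) := by
  induction s with
  | zero => exact h.odd_one
  | succ s ih =>
    obtain ⟨j, hj, hd⟩ := exists_odd_of_dirF ih
    rw [(h.chain (s + 1) (by omega)).1, hd]
    simpa using hj

lemma tip (h : IsSpine L X z) (s : ℕ) : IsTip (s + 1) (X (s + 1)) := by
  cases s with
  | zero => exact h.tip_one
  | succ s => exact (h.chain (s + 1) (by omega)).2.1

lemma spineRow_succ (h : IsSpine L X z) (s : ℕ) :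
    spineRow L (s + 1) = spineRow L s + dirF (L (s + 1)) * (3 * 2 ^ s) := by
  obtain ⟨j, hj, hd⟩ := exists_odd_of_dirF (h.odd s)
  have h1 := (h.chain (s + 1) (by omega)).1
  rw [hd, Int.mul_ediv_cancel_left _ two_ne_zero] at h1
  unfold spineRow
  rw [h1, pow_succ]
  linear_combination (-(3 * 2 ^ s)) * hd

lemma tip_le (h : IsSpine L X z) (s : ℕ) :
    X (s + 2) ≤ X (s + 1) := (h.chain (s + 1) (by omega)).2.2.1

lemma cornerCol_add_le (h : IsSpine L X z) (s : ℕ) :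
    cornerCol X s + bF (s + 1) ≤ cornerCol X (s + 1) := by
  obtain ⟨-, h2, h3, h4⟩ := h.chain (s + 1) (by omega)
  have hb : (0 : ℤ) < bF (s + 1) := by exact_mod_cast bF_pos _
  have hX := (h.tip s).dvd
  obtain ⟨t, ht⟩ := h2.dvd
  have h5 := (h.tip s).emod_add_lt (by omega) le_rfl le_rfl (by linarith)
  rw [show X (s + 1) = (X (s + 1) - X (s + 1 + 1)) + (bF (s + 1 + 1) : ℤ) * t by rw [← ht]; ring,
    Int.add_mul_emod_self_left, Int.emod_eq_of_lt (by linarith) (by linarith)] at h5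
  have hN : (bF (s + 1) : ℤ) ∣ bF (s + 1 + 1) := by exact_mod_cast bF_dvd_bF (Nat.le_succ _)
  have h6 := block_subset (a := X (s + 1) + bF (s + 1)) (Y := X (s + 1 + 1)) hb
    (dvd_add hX (dvd_refl _)) (hN.trans h2.dvd) hN
    le_rfl (by linarith) (by linarith) (by linarith)
  unfold cornerCol
  linarith [h6.2]

lemma cornerCol_lt (h : IsSpine L X z) (s : ℕ) : cornerCol X s < cornerCol X (s + 1) := by
  have hb : (0 : ℤ) < bF (s + 1) := by exact_mod_cast bF_pos _
  linarith [h.cornerCol_add_le s]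

lemma cornerCol_strictMono (h : IsSpine L X z) :
    StrictMono (cornerCol X) := strictMono_nat_of_lt_succ h.cornerCol_lt

lemma tip_le_cornerCol (s : ℕ) : X (s + 1) ≤ cornerCol X s := by
  have hb : (0 : ℤ) < bF (s + 1) := by exact_mod_cast bF_pos _
  unfold cornerCol; linarith

lemma entryCol_le (h : IsSpine L X z) (s : ℕ) : entryCol X z s ≤ cornerCol X s := by
  cases s with
  | zero => exact h.start.2.2
  | succ s => exact (h.cornerCol_lt s).le

lemma tip_le_entryCol (h : IsSpine L X z) (s : ℕ) : X (s + 1) ≤ entryCol X z s := by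
  cases s with
  | zero => exact h.start.2.1
  | succ s => exact (h.tip_le s).trans (tip_le_cornerCol s)

lemma dvd_cornerCol_add_one (h : IsSpine L X z) {r s : ℕ} (hr : r ≤ s + 1) :
    (bF r : ℤ) ∣ cornerCol X s + 1 := by
  have h1 : (bF r : ℤ) ∣ bF (s + 1) := by exact_mod_cast bF_dvd_bF hr
  unfold cornerCol
  rw [sub_add_cancel]
  exact dvd_add (h1.trans (h.tip s).dvd) h1

lemma stageBox_subset_succ (h : IsSpine L X z) (s : ℕ) : stageBox L X s ⊆ stageBox L X (s + 1) := by
  rintro v ⟨h1, h2, h3⟩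
  refine ⟨(h.tip_le s).trans h1, h2.trans (h.cornerCol_lt s).le, ?_⟩
  rw [h.spineRow_succ s]
  have h4 : |dirF (L (s + 1)) * (3 * 2 ^ s)| = 3 * 2 ^ s := by
    rcases dirF_eq (L (s + 1)) with hd | hd <;> rw [hd, abs_mul] <;> simp
  calc |v.2 - (spineRow L s + dirF (L (s + 1)) * (3 * 2 ^ s))|
      = |(v.2 - spineRow L s) - dirF (L (s + 1)) * (3 * 2 ^ s)| := by congr 1; ring
    _ ≤ |v.2 - spineRow L s| + |dirF (L (s + 1)) * (3 * 2 ^ s)| := abs_sub _ _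
    _ < 3 * 2 ^ (s + 1) := by rw [h4, pow_succ]; linarith

lemma stageBox_mono (h : IsSpine L X z) :
    Monotone (stageBox L X) := monotone_nat_of_le_succ h.stageBox_subset_succ

/-- A branch of order at most `s + 1` with a column in the box has all its columns there. -/
lemma block_in (h : IsSpine L X z) {m s : ℕ} {x a : ℤ} (hx : IsTip m x) (hm : m ≤ s + 1)
    (h1 : x ≤ a)
    (h2 : a < x + bF m) (h3 : X (s + 1) ≤ a) (h4 : a ≤ cornerCol X s) :
    X (s + 1) ≤ x ∧ x + bF m ≤ X (s + 1) + bF (s + 1) := by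
  have h5 : (bF m : ℤ) ∣ bF (s + 1) := by exact_mod_cast bF_dvd_bF hm
  refine block_subset (by exact_mod_cast bF_pos _) hx.dvd (h5.trans (h.tip s).dvd) h5 h1 h2 h3 ?_
  unfold cornerCol at h4; linarith

lemma not_in_top_block (h : IsSpine L X z) {m s : ℕ} (hm : s + 2 ≤ m) {x a : ℤ} (hx : IsTip m x)
    (h1 : x + bF m - bF (m - 1) ≤ a) (h2 : a < x + bF m)
    (h3 : X (s + 1) ≤ a) (h4 : a ≤ cornerCol X s) : False := by
  obtain ⟨r, rfl⟩ : ∃ r, m = r + 1 := ⟨m - 1, by omega⟩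
  rw [Nat.add_sub_cancel] at h1
  have h5 := (h.tip s).emod_add_lt (r := r) (by omega) (by omega) h3
    (by unfold cornerCol at h4; linarith)
  obtain ⟨t, ht⟩ := hx.dvd
  have hb : (bF r : ℤ) ≤ bF (r + 1) := by exact_mod_cast bF_mono (Nat.le_succ r)
  rw [show a = (a - x) + (bF (r + 1) : ℤ) * t by rw [← ht]; ring,
    Int.add_mul_emod_self_left, Int.emod_eq_of_lt (by linarith) (by linarith)] at h5
  linarith

end IsSpine

namespace IsSpine

variable {L X : ℕ → ℤ} {z : V} {γ : ℝ}

lemma ne_cornerCol (h : IsSpine L X z) {m s : ℕ} (hm : 1 ≤ m) (hms : m ≤ s) {x a : ℤ}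
    (hx : IsTip m x) (h1 : x ≤ a)
    (h2 : a < x + bF m) : a ≠ cornerCol X s := by
  rintro rfl
  have h3 := hx.emod_add_lt hm hms h1 h2
  obtain ⟨t, ht⟩ := h.dvd_cornerCol_add_one (le_refl (s + 1))
  have hb : (0 : ℤ) < bF s := by exact_mod_cast bF_pos _
  have hb' : (0 : ℤ) < bF (s + 1) := by exact_mod_cast bF_pos _
  rw [show cornerCol X s = (bF (s + 1) - 1 : ℤ) + (bF (s + 1) : ℤ) * (t - 1) by linarith,
    Int.add_mul_emod_self_left, Int.emod_eq_of_lt (by linarith) (by linarith)] at h3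
  linarith

lemma ediv_eq_of_block {m s : ℕ} (hms : m ≤ s) {x a b : ℤ} (hx : IsTip m x) (ha : x ≤ a)
    (ha' : a < x + bF m) (hb : x ≤ b) (hb' : b < x + bF m) : a / bF s = b / bF s := by
  have hp : (0 : ℤ) < bF s := by exact_mod_cast bF_pos _
  have hd : (bF m : ℤ) ∣ bF s := by exact_mod_cast bF_dvd_bF hms
  have h1 := Int.emod_nonneg a hp.ne'
  have h2 := Int.emod_lt_of_pos a hp
  have h3 := Int.mul_ediv_add_emod a (bF s)
  have h4 := block_subset (Y := bF s * (a / bF s)) (N := bF s) (by exact_mod_cast bF_pos _) hx.dvd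
    (hd.mul_right _) hd ha ha' (by linarith) (by linarith)
  symm
  rw [Int.ediv_eq_iff_of_pos hp]
  constructor <;> linarith

lemma localEdge_of_low (h : IsSpine L X z) {m s : ℕ} (hm : 1 ≤ m) (hms : m ≤ s) {x : ℤ}
    (hx : IsTip m x) {p q : V}
    (hp : x ≤ p.1 ∧ p.1 < x + bF m) (hq : x ≤ q.1 ∧ q.1 < x + bF m)
    (hpq : |p.2 - q.2| ≤ 1)
    (hrow : ∀ r ∈ ({p.2, q.2} : Set ℤ), r ≠ spineRow L s + 3 * 2 ^ s ∧ r ≠ spineRow L s - 3 * 2 ^ s)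
    (hhit : ∀ r ∈ ({p.2, q.2} : Set ℤ), r = spineRow L s → p.1 = q.1 ∧ (bF s : ℤ) ∣ p.1 + 1)
    (hin : p ∈ stageBox L X s ∨ q ∈ stageBox L X s) : LocalEdge L X s p q := by
  have hp1 := hrow p.2 (by simp)
  have hq1 := hrow q.2 (by simp)
  have hcol : (X (s + 1) ≤ p.1 ∧ p.1 ≤ cornerCol X s) ∧ X (s + 1) ≤ q.1 ∧ q.1 ≤ cornerCol X s := by
    unfold cornerCol
    rcases hin with ⟨h1, h2, -⟩ | ⟨h1, h2, -⟩
    · have := h.block_in hx (by omega) hp.1 hp.2 h1 h2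
      omega
    · have := h.block_in hx (by omega) hq.1 hq.2 h1 h2
      omega
  have hbox : p ∈ stageBox L X s ∧ q ∈ stageBox L X s := by
    refine ⟨⟨hcol.1.1, hcol.1.2, ?_⟩, ⟨hcol.2.1, hcol.2.2, ?_⟩⟩
    all_goals
      rw [abs_le] at hpq
      rw [abs_lt]
      rcases hin with ⟨-, -, h3⟩ | ⟨-, -, h3⟩
      all_goals
        rw [abs_lt] at h3
        omega
  refine Or.inr (Or.inr ⟨hbox.1, hbox.2, h.ne_cornerCol hm hms hx hp.1 hp.2,
    h.ne_cornerCol hm hms hx hq.1 hq.2, ediv_eq_of_block hms hx hp.1 hp.2 hq.1 hq.2, ?_⟩)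
  rintro (h1 | h1)
  exacts [hhit _ (by simp) h1, hhit _ (by simp) h1]

lemma spineRow_eq_mul {m s : ℕ} (hm : 1 ≤ m) (hms : m ≤ s) :
    spineRow L s = 2 * (3 * 2 ^ (m - 1)) * (2 ^ (s - m) * L (s + 1)) := by
  obtain ⟨r, rfl⟩ : ∃ r, m = r + 1 := ⟨m - 1, by omega⟩
  obtain ⟨t, rfl⟩ : ∃ t, s = r + 1 + t := ⟨s - (r + 1), by omega⟩
  unfold spineRow
  rw [Nat.add_sub_cancel, Nat.add_sub_cancel_left, pow_add, pow_succ]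
  ring

lemma three_mul_two_pow_eq_mul {m s : ℕ} (hm : 1 ≤ m) (hms : m ≤ s) :
    (3 * 2 ^ s : ℤ) = 2 * (3 * 2 ^ (m - 1)) * 2 ^ (s - m) := by
  obtain ⟨r, rfl⟩ : ∃ r, m = r + 1 := ⟨m - 1, by omega⟩
  obtain ⟨t, rfl⟩ : ∃ t, s = r + 1 + t := ⟨s - (r + 1), by omega⟩
  rw [Nat.add_sub_cancel, Nat.add_sub_cancel_left, pow_add, pow_succ]
  ring

lemma exists_boundary_eq (h : IsSpine L X z) {m s : ℕ} (hm : 1 ≤ m) (hms : m ≤ s) {r : ℤ}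
    (hr : r = spineRow L s + 3 * 2 ^ s ∨ r = spineRow L s - 3 * 2 ^ s) :
    ∃ A, Even A ∧ r = 2 * (3 * 2 ^ (m - 1)) * A := by
  have h1 := h.odd s
  rcases hr with rfl | rfl
  · refine ⟨2 ^ (s - m) * (L (s + 1) + 1), (h1.add_odd _root_.odd_one).mul_left _, ?_⟩
    rw [spineRow_eq_mul hm hms, three_mul_two_pow_eq_mul hm hms]; ring
  · refine ⟨2 ^ (s - m) * (L (s + 1) - 1), (h1.sub_odd _root_.odd_one).mul_left _, ?_⟩
    rw [spineRow_eq_mul hm hms, three_mul_two_pow_eq_mul hm hms]; ring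

/-- Two branches of the same order with a common column have the same tip column. -/
lemma tip_eq (h : IsSpine L X z) {s : ℕ} {x a : ℤ} (hx : IsTip (s + 1) x) (h1 : x ≤ a)
    (h2 : a < x + bF (s + 1)) (h3 : X (s + 1) ≤ a) (h4 : a ≤ cornerCol X s) : x = X (s + 1) := by
  have h5 := h.block_in hx le_rfl h1 h2 h3 h4
  linarith [h5.1, h5.2]

lemma rowY_succ (s : ℕ) (l : ℤ) : rowY (s + 1) l = 3 * 2 ^ s * l := rfl

/-- A point in the box of stage `s`, within distance `3 * 2 ^ s` of the row of a branch of order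
`s + 1`, determines the branch. -/
lemma eq_of_mem_stageBox (h : IsSpine L X z) {s : ℕ} {l x : ℤ} (hl : Odd l) (hx : IsTip (s + 1) x)
    {p : V}
    (h1 : x ≤ p.1) (h2 : p.1 < x + bF (s + 1)) (h3 : |p.2 - rowY (s + 1) l| ≤ 3 * 2 ^ s)
    (hp : p ∈ stageBox L X s) : l = L (s + 1) ∧ x = X (s + 1) := by
  refine ⟨eq_of_abs_row_sub_lt (h.odd s) hl h3 ?_, h.tip_eq hx h1 h2 hp.1 hp.2.1⟩
  have := hp.2.2
  unfold spineRow at this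
  rw [rowY_succ]
  convert this using 2
  ring

lemma rowY_notMem_box (h : IsSpine L X z) {m s : ℕ} (hm : s + 2 ≤ m) (l : ℤ) {p : V}
    (hp : p ∈ stageBox L X s) :
    p.2 ≠ rowY m l := by
  intro h1
  obtain ⟨t, rfl⟩ : ∃ t, m = s + 2 + t := ⟨m - (s + 2), by omega⟩
  obtain ⟨q, hq⟩ := h.odd s
  have h2 := hp.2.2
  rw [h1, rowY, spineRow, hq, show s + 2 + t - 1 = s + (t + 1) by omega, pow_add, pow_succ,
    show (3 * (2 ^ s * (2 ^ t * 2)) * l - 3 * 2 ^ s * (2 * q + 1) : ℤ) =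
      3 * 2 ^ s * (2 * (2 ^ t * l - q) - 1) by ring, abs_mul,
    abs_of_pos (by positivity : (0 : ℤ) < 3 * 2 ^ s)] at h2
  have h3 : |2 * (2 ^ t * l - q) - 1| < 1 := by
    have : (0 : ℤ) < 3 * 2 ^ s := by positivity
    nlinarith
  rw [abs_lt] at h3
  omega

lemma localEdge_of_branchEdge (h : IsSpine L X z) {m s : ℕ} {l x : ℤ} (hm : 1 ≤ m) (hl : Odd l)
    (hx : IsTip m x)
    {p q : V} (he : BranchEdge m l x p q) (hin : p ∈ stageBox L X s ∨ q ∈ stageBox L X s) :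
    LocalEdge L X s p q := by
  have hb : (0 : ℤ) < bF m := by exact_mod_cast bF_pos _
  rcases lt_or_ge (s + 1) m with hms | hms
  · exfalso
    have hb' : (0 : ℤ) < bF (m - 1) := by exact_mod_cast bF_pos _
    rcases he with ⟨h1, h2, -⟩ | ⟨h1, h2, -⟩
    · rcases hin with hin | hin
      exacts [h.rowY_notMem_box hms l hin h1, h.rowY_notMem_box hms l hin h2]
    · rcases hin with hin | hin
      · exact h.not_in_top_block hms hx (by linarith) (by linarith) hin.1 hin.2.1
      · exact h.not_in_top_block hms hx (by linarith) (by linarith) hin.1 hin.2.1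
  rcases hms.eq_or_lt with rfl | hms
  · have hs : (0 : ℤ) < 3 * 2 ^ s := by positivity
    rcases he with ⟨h1, h2, h3, h4, h5⟩ | ⟨h1, h2, j, h3, h4, h5, h6⟩
    · have hlx : l = L (s + 1) ∧ x = X (s + 1) := by
        rcases hin with hin | hin
        · exact h.eq_of_mem_stageBox hl hx h4 (by linarith) (by rw [h1]; simp) hin
        · exact h.eq_of_mem_stageBox hl hx (by linarith) (by linarith) (by rw [h2]; simp) hin
      obtain ⟨rfl, rfl⟩ := hlx
      refine Or.inl ⟨h1, h2, ⟨h4, ?_, ?_⟩, ⟨?_, ?_, ?_⟩, h3⟩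
      · unfold cornerCol; linarith
      · rw [h1]; unfold spineRow rowY; simp
      · linarith
      · unfold cornerCol; linarith
      · rw [h2]; unfold spineRow rowY; simp
    · have h4' : j < 3 * 2 ^ s := h4
      have habs : ∀ i : ℤ, 0 ≤ i → i ≤ 3 * 2 ^ s → |dirF l * i| ≤ 3 * 2 ^ s := by
        intro i hi hi'
        rcases dirF_eq l with hd | hd <;> rw [hd] <;> simp [abs_of_nonneg hi, hi']
      have hlx : l = L (s + 1) ∧ x = X (s + 1) := by
        rcases hin with hin | hin
        · exact h.eq_of_mem_stageBox hl hx (by linarith) (by linarith)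
            (by rw [h5, add_sub_cancel_left]; exact habs j h3 h4'.le) hin
        · exact h.eq_of_mem_stageBox hl hx (by linarith) (by linarith)
            (by rw [h6, add_sub_cancel_left]; exact habs (j + 1) (by omega) h4') hin
      obtain ⟨rfl, rfl⟩ := hlx
      exact Or.inr (Or.inl ⟨h1, h2, j, h3, h4', h5, h6⟩)
  · have hms : m ≤ s := by omega
    have hg : (0 : ℤ) < 3 * 2 ^ (m - 1) := by positivity
    have hkey : ∀ r ∈ ({p.2, q.2} : Set ℤ), ∀ A, r = 2 * (3 * 2 ^ (m - 1)) * A →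
        Odd A ∧ p.1 = x + bF m - 1 ∧ p.1 = q.1 := by
      intro r hr A hA
      rcases he with ⟨h1, h2, h3, h4, h5⟩ | ⟨h1, h2, j, h3, h4, h5, h6⟩
      · exfalso
        have : r = rowY m l := by rcases hr with rfl | rfl; exacts [h1, h2]
        exact row_add_ne (A := A) hl le_rfl hg (by rw [← hA, this]; simp [rowY])
      · refine ⟨?_, h1, by rw [h1, h2]⟩
        rcases hr with rfl | rfl
        · exact (abutment_row_eq hg hl h3 h4.le (h5.symm.trans hA)).2
        · exact (abutment_row_eq hg hl (by omega) h4 (h6.symm.trans hA)).2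
    refine h.localEdge_of_low hm hms hx ?_ ?_ ?_ ?_ ?_ hin
    · rcases he with ⟨h1, h2, h3, h4, h5⟩ | ⟨h1, h2, -⟩ <;> constructor <;> linarith
    · rcases he with ⟨h1, h2, h3, h4, h5⟩ | ⟨h1, h2, -⟩ <;> constructor <;> linarith
    · rcases he with ⟨h1, h2, h3, h4, h5⟩ | ⟨h1, h2, j, h3, h4, h5, h6⟩
      · rw [h1, h2]; simp
      · rw [h5, h6, show rowY m l + dirF l * j - (rowY m l + dirF l * (j + 1)) = -dirF l by ring]
        rcases dirF_eq l with hd | hd <;> rw [hd] <;> simp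
    · intro r hr
      by_contra hc
      obtain ⟨A, hA, hrA⟩ := h.exists_boundary_eq hm hms (r := r) (by tauto)
      exact Int.not_even_iff_odd.2 (hkey r hr A hrA).1 hA
    · intro r hr hrow
      rw [spineRow_eq_mul hm hms] at hrow
      obtain ⟨h1, h2, h3⟩ := hkey r hr _ hrow
      have h4 : m = s := by
        by_contra hne
        have : Even ((2 : ℤ) ^ (s - m)) := (even_two (α := ℤ)).pow_of_ne_zero (by omega)
        exact Int.not_even_iff_odd.2 h1 (this.mul_right _)
      subst h4
      refine ⟨h3, ?_⟩
      rw [h2, sub_add_cancel]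
      exact dvd_add hx.dvd dvd_rfl

lemma localEdge_of_trapEdge (h : IsSpine L X z) {m s : ℕ} {l x : ℤ} (hm : 2 ≤ m) (hl : Odd l)
    (hx : IsTip m x)
    {p q : V} (he : TrapEdge m l x p q) (hne : ¬ (m = s + 1 ∧ l = L m ∧ x = X m))
    (hin : p ∈ stageBox L X s ∨ q ∈ stageBox L X s) : LocalEdge L X s p q := by
  obtain ⟨⟨h1, h2⟩, ⟨h3, h4⟩, h5⟩ := he
  have hb : (bF (m - 1) : ℤ) ≤ bF m := by exact_mod_cast bF_mono (by omega)
  rcases lt_or_ge (s + 1) m with hms | hms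
  · exfalso
    rcases hin with hin | hin
    · exact h.not_in_top_block hms hx h1 (by linarith) hin.1 hin.2.1
    · exact h.not_in_top_block hms hx h3 (by linarith) hin.1 hin.2.1
  rcases hms.eq_or_lt with rfl | hms
  · exfalso
    have hs : (3 : ℤ) ≤ 3 * 2 ^ s := by
      have : (0 : ℤ) < 2 ^ s := by positivity
      linarith
    have hlx : l = L (s + 1) ∧ x = X (s + 1) := by
      rcases hin with hin | hin
      · exact h.eq_of_mem_stageBox hl hx (by linarith) (by linarith)
          (by rw [abs_le]; omega) hin
      · exact h.eq_of_mem_stageBox hl hx (by linarith) (by linarith)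
          (by rw [abs_le]; omega) hin
    exact hne ⟨rfl, hlx⟩
  · have hms : m ≤ s := by omega
    have hg : (3 : ℤ) ≤ 3 * 2 ^ (m - 1) := by
      have : (0 : ℤ) < 2 ^ (m - 1) := by positivity
      linarith
    have hkey : ∀ r ∈ ({p.2, q.2} : Set ℤ), ∀ A, r ≠ 2 * (3 * 2 ^ (m - 1)) * A := by
      intro r hr A hA
      have hr' : 0 ≤ r - rowY m l ∧ r - rowY m l ≤ 2 := by
        rcases hr with rfl | rfl <;> omega
      exact row_add_ne (g := 3 * 2 ^ (m - 1)) (A := A) hl hr'.1 (by linarith) (by rw [← hA]; simp [rowY])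
    refine h.localEdge_of_low (by omega) hms hx ⟨by linarith, by linarith⟩
      ⟨by linarith, by linarith⟩ (by rw [abs_le]; omega) ?_ ?_ hin
    · intro r hr
      by_contra hc
      obtain ⟨A, -, hrA⟩ := h.exists_boundary_eq (by omega) hms (r := r) (by tauto)
      exact hkey r hr A hrA
    · intro r hr hrow
      rw [spineRow_eq_mul (by omega) hms] at hrow
      exact absurd hrow (hkey r hr _)

lemma localEdge (h : IsSpine L X z) {s : ℕ} {v w : V} (he : s(v, w) ∈ prunedEdges γ L X)
    (hin : v ∈ stageBox L X s ∨ w ∈ stageBox L X s) :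
    LocalEdge L X s v w ∨ LocalEdge L X s w v := by
  obtain ⟨h1 | ⟨m, l, x, hm, hl, hx, h1⟩, h2⟩ := he
  · obtain ⟨m, l, x, hm, hl, hx, h1 | h1⟩ := branchEdge_of_mem h1
    · exact Or.inl (h.localEdge_of_branchEdge hm hl hx h1 hin)
    · exact Or.inr (h.localEdge_of_branchEdge hm hl hx h1 hin.symm)
  · have hne : ¬ (m = s + 1 ∧ l = L m ∧ x = X m) := by
      rintro ⟨-, rfl, rfl⟩
      exact h2 ⟨m, hm, h1⟩
    rcases trapEdge_of_mem h1 with h1 | h1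
    · exact Or.inl (h.localEdge_of_trapEdge hm hl hx h1 hne hin)
    · exact Or.inr (h.localEdge_of_trapEdge hm hl hx h1 hne hin.symm)

end IsSpine

/-- The first stage whose box contains the vertex. -/
def stage (L X : ℕ → ℤ) (v : V) : ℕ := sInf {s | v ∈ stageBox L X s}

/-- The last column of the block of length `b_s` containing the column `a`. -/
def blockEnd (s : ℕ) (a : ℤ) : ℤ := bF s * (a / bF s) + bF s - 1

/-- Column of the projection to the infinite path of a vertex of the box of stage `s`. -/
def projCol (L X : ℕ → ℤ) (z : V) (s : ℕ) (v : V) : ℤ :=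
  if v.2 = spineRow L s then max (entryCol X z s) v.1
  else max (entryCol X z s) (blockEnd s v.1)

/-- Distance to the main part of the projection to the infinite path of a vertex of the box of
stage `s`. -/
def projHeight (L X : ℕ → ℤ) (s : ℕ) (v : V) : ℤ :=
  if v.1 = cornerCol X s then max 0 (dirF (L (s + 1)) * (v.2 - spineRow L s)) else 0

/-- Position along the infinite path of the projection of a vertex. -/
def pathPos (L X : ℕ → ℤ) (z : V) (v : V) : ℤ :=
  projCol L X z (stage L X v) v + projHeight L X (stage L X v) v + 3 * 2 ^ stage L X v

/-- The vertex lies on the infinite path, on the branch of order `s + 1` of the chain (the root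
of the branch being excluded). -/
def OnSpine (L X : ℕ → ℤ) (z : V) (s : ℕ) (v : V) : Prop :=
  (v.2 = spineRow L s ∧ entryCol X z s ≤ v.1 ∧ v.1 ≤ cornerCol X s) ∨
  (v.1 = cornerCol X s ∧ ∃ j : ℤ, 0 ≤ j ∧ j < 3 * 2 ^ s ∧
    v.2 = spineRow L s + dirF (L (s + 1)) * j)

/-- The infinite path goes from `v` to `w` in one step, on the branch of order `s + 1` of the
chain. -/
def SpineStep (L X : ℕ → ℤ) (z : V) (s : ℕ) (v w : V) : Prop :=
  (v.2 = spineRow L s ∧ w.2 = spineRow L s ∧ w.1 = v.1 + 1 ∧ entryCol X z s ≤ v.1 ∧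
    v.1 < cornerCol X s) ∨
  (v.1 = cornerCol X s ∧ w.1 = cornerCol X s ∧ ∃ j : ℤ, 0 ≤ j ∧ j < 3 * 2 ^ s ∧
    v.2 = spineRow L s + dirF (L (s + 1)) * j ∧
    w.2 = spineRow L s + dirF (L (s + 1)) * (j + 1))

lemma stage_le {L X : ℕ → ℤ} {s : ℕ} {v : V} (hv : v ∈ stageBox L X s) : stage L X v ≤ s :=
  Nat.sInf_le hv

lemma mem_stageBox_stage {L X : ℕ → ℤ} {s : ℕ} {v : V} (hv : v ∈ stageBox L X s) :
    v ∈ stageBox L X (stage L X v) := Nat.sInf_mem (s := {s | v ∈ stageBox L X s}) ⟨s, hv⟩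

lemma le_blockEnd (s : ℕ) (a : ℤ) : a ≤ blockEnd s a := by
  have hp : (0 : ℤ) < bF s := by exact_mod_cast bF_pos _
  have h2 := Int.emod_lt_of_pos a hp
  have h3 := Int.mul_ediv_add_emod a (bF s)
  unfold blockEnd; linarith

lemma blockEnd_le {s : ℕ} {a c : ℤ} (hc : (bF s : ℤ) ∣ c + 1) (h : a ≤ c) : blockEnd s a ≤ c := by
  obtain ⟨t, ht⟩ := hc
  have hp : (0 : ℤ) < bF s := by exact_mod_cast bF_pos _
  have h3 := Int.mul_ediv_add_emod a (bF s)
  have h4 := Int.emod_nonneg a hp.ne'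
  have h5 : a / bF s < t := by nlinarith
  unfold blockEnd
  nlinarith

lemma blockEnd_eq {s : ℕ} {a : ℤ} (ha : (bF s : ℤ) ∣ a + 1) : blockEnd s a = a :=
  le_antisymm (blockEnd_le ha le_rfl) (le_blockEnd s a)

namespace IsSpine

variable {L X : ℕ → ℤ} {z : V} {γ : ℝ}

lemma dvd_cornerCol (h : IsSpine L X z) {s : ℕ} :
    (bF s : ℤ) ∣ cornerCol X s + 1 := h.dvd_cornerCol_add_one (by omega)

lemma projCol_of_corner (h : IsSpine L X z) {s : ℕ} {v : V} (hv : v.1 = cornerCol X s) :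
    projCol L X z s v = cornerCol X s := by
  unfold projCol
  rw [hv, blockEnd_eq h.dvd_cornerCol, ite_self, max_eq_right (h.entryCol_le s)]

lemma le_projCol (s : ℕ) (v : V) : entryCol X z s ≤ projCol L X z s v := by
  unfold projCol; split_ifs <;> exact le_max_left _ _

lemma projCol_le (h : IsSpine L X z) {s : ℕ} {v : V} (hv : v.1 ≤ cornerCol X s) :
    projCol L X z s v ≤ cornerCol X s := by
  unfold projCol
  split_ifs
  · exact max_le (h.entryCol_le s) hv
  · exact max_le (h.entryCol_le s) (blockEnd_le h.dvd_cornerCol hv)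

lemma projHeight_nonneg (s : ℕ) (v : V) : 0 ≤ projHeight L X s v := by
  unfold projHeight; split_ifs <;> simp

lemma projHeight_lt {s : ℕ} {v : V} (hv : v ∈ stageBox L X s) :
    projHeight L X s v < 3 * 2 ^ s := by
  have h1 := hv.2.2
  have h2 : (0 : ℤ) < 3 * 2 ^ s := by positivity
  unfold projHeight
  split_ifs
  · refine max_lt h2 (lt_of_le_of_lt (le_abs_self _) ?_)
    rw [abs_mul]
    rcases dirF_eq (L (s + 1)) with hd | hd <;> rw [hd] <;> simpa using h1
  · exact h2

lemma projHeight_of_row {s : ℕ} {v : V} (hv : v.2 = spineRow L s) : projHeight L X s v = 0 := by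
  unfold projHeight; rw [hv]; simp

lemma projHeight_of_corner {s : ℕ} {v : V} (hv : v.1 = cornerCol X s) {j : ℤ} (hj : 0 ≤ j)
    (hv' : v.2 = spineRow L s + dirF (L (s + 1)) * j) : projHeight L X s v = j := by
  unfold projHeight
  rw [if_pos hv, hv', add_sub_cancel_left, ← mul_assoc]
  rcases dirF_eq (L (s + 1)) with hd | hd <;> rw [hd] <;> simp [hj]

lemma mem_stageBox_of_onSpine (h : IsSpine L X z) {s : ℕ} {v : V} (hv : OnSpine L X z s v) :
    v ∈ stageBox L X s := by
  have h2 : (0 : ℤ) < 3 * 2 ^ s := by positivity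
  rcases hv with ⟨h1, h3, h4⟩ | ⟨h1, j, h3, h4, h5⟩
  · exact ⟨(h.tip_le_entryCol s).trans h3, h4, by rw [h1]; simp⟩
  · refine ⟨h1 ▸ tip_le_cornerCol s, h1.le, ?_⟩
    rw [h5, add_sub_cancel_left]
    rcases dirF_eq (L (s + 1)) with hd | hd <;> rw [hd] <;> simpa [abs_of_nonneg h3] using h4

lemma stage_eq (h : IsSpine L X z) {s : ℕ} {v : V} (hv : OnSpine L X z s v) : stage L X v = s := by
  have h1 := h.mem_stageBox_of_onSpine hv
  refine le_antisymm (stage_le h1) ?_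
  by_contra hlt
  push Not at hlt
  obtain ⟨r, rfl⟩ : ∃ r, s = r + 1 := ⟨s - 1, by omega⟩
  have h2 := h.stageBox_mono (Nat.lt_succ_iff.1 hlt) (mem_stageBox_stage h1)
  rcases hv with ⟨h3, -, -⟩ | ⟨h3, -⟩
  · have h4 := h2.2.2
    rw [h3, h.spineRow_succ, add_sub_cancel_left, abs_mul] at h4
    rcases dirF_eq (L (r + 1)) with hd | hd <;> rw [hd] at h4 <;> simp at h4
  · exact absurd h2.2.1 (by rw [h3]; exact not_le.2 (h.cornerCol_lt r))

lemma onSpine_left {s : ℕ} {v w : V} (hv : SpineStep L X z s v w) : OnSpine L X z s v := by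
  rcases hv with ⟨h1, h2, h3, h4, h5⟩ | ⟨h1, h2, j, h3, h4, h5, h6⟩
  exacts [Or.inl ⟨h1, h4, h5.le⟩, Or.inr ⟨h1, j, h3, h4, h5⟩]

/-- Coordinates of a path vertex: the stage, the column and the height of its projection. -/
def Coords (L X : ℕ → ℤ) (z : V) (v : V) (s : ℕ) (x j : ℤ) : Prop :=
  OnSpine L X z s v ∧ projCol L X z s v = x ∧ projHeight L X s v = j

lemma coords_row {s : ℕ} {v : V} (h1 : v.2 = spineRow L s) (h2 : entryCol X z s ≤ v.1)
    (h3 : v.1 ≤ cornerCol X s) : Coords L X z v s v.1 0 :=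
  ⟨Or.inl ⟨h1, h2, h3⟩, by unfold projCol; rw [if_pos h1, max_eq_right h2], projHeight_of_row h1⟩

lemma coords_corner (h : IsSpine L X z) {s : ℕ} {v : V} {j : ℤ} (h1 : v.1 = cornerCol X s)
    (hj : 0 ≤ j)
    (hj' : j < 3 * 2 ^ s) (h2 : v.2 = spineRow L s + dirF (L (s + 1)) * j) :
    Coords L X z v s (cornerCol X s) j :=
  ⟨Or.inr ⟨h1, j, hj, hj', h2⟩, h.projCol_of_corner h1, projHeight_of_corner h1 hj h2⟩

/-- The three kinds of steps of the infinite path. -/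
lemma coords_of_step (h : IsSpine L X z) {s : ℕ} {v w : V} (hv : SpineStep L X z s v w) :
    ∃ x j, Coords L X z v s x j ∧ (Coords L X z w s (x + 1) j ∧ max v.1 w.1 = x + 1 ∨
      x = cornerCol X s ∧ max v.1 w.1 = x ∧
        (Coords L X z w s x (j + 1) ∨ j + 1 = 3 * 2 ^ s ∧ Coords L X z w (s + 1) x 0)) := by
  rcases hv with ⟨h1, h2, h3, h4, h5⟩ | ⟨h1, h2, j, h3, h4, h5, h6⟩
  · refine ⟨v.1, 0, coords_row h1 h4 h5.le, Or.inl ⟨h3 ▸ coords_row h2 (by omega) (by omega), ?_⟩⟩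
    omega
  · refine ⟨cornerCol X s, j, h.coords_corner h1 h3 h4 h5, Or.inr ⟨rfl, by omega, ?_⟩⟩
    rcases (show j + 1 ≤ 3 * 2 ^ s from h4).lt_or_eq with h7 | h7
    · exact Or.inl (h.coords_corner h2 (by omega) h7 h6)
    · refine Or.inr ⟨h7, ?_⟩
      rw [h7, ← h.spineRow_succ] at h6
      have := coords_row (z := z) (s := s + 1) h6 h2.ge (h2 ▸ (h.cornerCol_lt s).le)
      rwa [h2] at this

lemma pathPos_eq (h : IsSpine L X z) {v : V} {s : ℕ} {x j : ℤ} (hv : Coords L X z v s x j) :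
    pathPos L X z v = x + j + 3 * 2 ^ s := by
  unfold pathPos
  rw [h.stage_eq hv.1, hv.2.1, hv.2.2]

lemma pathPos_of_step (h : IsSpine L X z) {s : ℕ} {v w : V} (hv : SpineStep L X z s v w) :
    pathPos L X z w = pathPos L X z v + 1 := by
  obtain ⟨x, j, h1, ⟨h2, -⟩ | ⟨-, -, h2 | ⟨hj, h2⟩⟩⟩ := h.coords_of_step hv
  all_goals rw [h.pathPos_eq h1, h.pathPos_eq h2]
  · ring
  · ring
  · rw [pow_succ]; linear_combination (-1) * hj

lemma exists_onSpine_right (h : IsSpine L X z) {s : ℕ} {v w : V} (hv : SpineStep L X z s v w) :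
    ∃ t, OnSpine L X z t w := by
  obtain ⟨x, j, h1, ⟨h2, -⟩ | ⟨-, -, h2 | ⟨hj, h2⟩⟩⟩ := h.coords_of_step hv
  exacts [⟨_, h2.1⟩, ⟨_, h2.1⟩, ⟨_, h2.1⟩]

/-- First position along the path on the branch of order `s + 1`. -/
lemma entry_mono (h : IsSpine L X z) : Monotone fun s => entryCol X z s + 3 * 2 ^ s := by
  refine monotone_nat_of_le_succ fun s => ?_
  have h1 := h.entryCol_le s
  have h2 : (0 : ℤ) < 2 ^ s := by positivity
  change entryCol X z s + 3 * 2 ^ s ≤ cornerCol X s + 3 * 2 ^ (s + 1)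
  rw [pow_succ]
  linarith

lemma pathPos_bounds (h : IsSpine L X z) {s : ℕ} {v : V} (hv : v ∈ stageBox L X s)
    (hs : stage L X v = s) :
    entryCol X z s + 3 * 2 ^ s ≤ pathPos L X z v ∧
      pathPos L X z v < entryCol X z (s + 1) + 3 * 2 ^ (s + 1) := by
  have h1 := le_projCol (L := L) (X := X) (z := z) s v
  have h2 := h.projCol_le hv.2.1
  have h3 := projHeight_nonneg (L := L) (X := X) s v
  have h4 := projHeight_lt hv
  unfold pathPos
  rw [hs, entryCol, pow_succ]
  constructor <;> linarith

lemma onSpine_injective (h : IsSpine L X z) {s t : ℕ} {v w : V} (hv : OnSpine L X z s v)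
    (hw : OnSpine L X z t w)
    (he : pathPos L X z v = pathPos L X z w) : v = w := by
  have h1 := h.pathPos_bounds (h.mem_stageBox_of_onSpine hv) (h.stage_eq hv)
  have h2 := h.pathPos_bounds (h.mem_stageBox_of_onSpine hw) (h.stage_eq hw)
  have hst : s = t := by
    rcases lt_trichotomy s t with hlt | rfl | hlt
    · have := h.entry_mono (Nat.succ_le_of_lt hlt)
      simp only [Nat.succ_eq_add_one] at this
      linarith
    · rfl
    · have := h.entry_mono (Nat.succ_le_of_lt hlt)
      simp only [Nat.succ_eq_add_one] at this
      linarith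
  subst hst
  have hd : dirF (L (s + 1)) ≠ 0 := by rcases dirF_eq (L (s + 1)) with hd | hd <;> rw [hd] <;> simp
  rcases hv with ⟨a1, a2, a3⟩ | ⟨a1, j, a2, a3, a4⟩ <;>
    rcases hw with ⟨b1, b2, b3⟩ | ⟨b1, i, b2, b3, b4⟩
  · rw [h.pathPos_eq (coords_row a1 a2 a3), h.pathPos_eq (coords_row b1 b2 b3)] at he
    exact Prod.ext (by linarith) (a1.trans b1.symm)
  · rw [h.pathPos_eq (coords_row a1 a2 a3), h.pathPos_eq (h.coords_corner b1 b2 b3 b4)] at he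
    have hi : i = 0 := by omega
    rw [hi, mul_zero, add_zero] at b4
    exact Prod.ext (by linarith) (a1.trans b4.symm)
  · rw [h.pathPos_eq (coords_row b1 b2 b3), h.pathPos_eq (h.coords_corner a1 a2 a3 a4)] at he
    have hi : j = 0 := by omega
    rw [hi, mul_zero, add_zero] at a4
    exact Prod.ext (by linarith) (a4.trans b1.symm)
  · rw [h.pathPos_eq (h.coords_corner b1 b2 b3 b4), h.pathPos_eq (h.coords_corner a1 a2 a3 a4)] at he
    have hi : i = j := by linarith
    exact Prod.ext (a1.trans b1.symm) (by rw [a4, b4, hi])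

lemma onSpine_start (h : IsSpine L X z) : OnSpine L X z 0 z := by
  have h1 : z.2 = spineRow L 0 := h.start.1
  exact Or.inl ⟨h1, le_rfl, h.start.2.2⟩

lemma pathPos_start (h : IsSpine L X z) : pathPos L X z z = z.1 + 3 := by
  have h1 : z.2 = spineRow L 0 := h.start.1
  rw [h.pathPos_eq (coords_row (s := 0) h1 le_rfl h.start.2.2)]
  ring

lemma pathPos_start_le (h : IsSpine L X z) {s : ℕ} {v : V} (hv : v ∈ stageBox L X s) :
    pathPos L X z z ≤ pathPos L X z v := by
  rw [h.pathPos_start]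
  refine le_trans ?_ (h.pathPos_bounds (mem_stageBox_stage hv) rfl).1
  simpa [entryCol] using h.entry_mono (Nat.zero_le (stage L X v))

/-- An edge with an endpoint in a box either is a step of the path, or joins vertices with the same
stage and the same projection. -/
lemma edge_cases (h : IsSpine L X z) {s : ℕ} {v w : V} (he : s(v, w) ∈ prunedEdges γ L X)
    (hv : v ∈ stageBox L X s) :
    (∃ t, w ∈ stageBox L X t) ∧
    ((∃ t, SpineStep L X z t v w ∨ SpineStep L X z t w v) ∨
      (stage L X w = stage L X v ∧
        projCol L X z (stage L X v) w = projCol L X z (stage L X v) v ∧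
        projHeight L X (stage L X v) w = projHeight L X (stage L X v) v)) := by
  have hbox : ∃ t, w ∈ stageBox L X t := by
    have hkey : ∀ p q, LocalEdge L X s p q → p ∈ stageBox L X (s + 1) ∧ q ∈ stageBox L X (s + 1) := by
      rintro p q (⟨-, -, hp, hq, -⟩ | ⟨h1, h2, j, h3, h4, h5, h6⟩ | ⟨hp, hq, -⟩)
      · exact ⟨h.stageBox_subset_succ s hp, h.stageBox_subset_succ s hq⟩
      · have hst : SpineStep L X z s p q := Or.inr ⟨h1, h2, j, h3, h4, h5, h6⟩
        refine ⟨h.stageBox_subset_succ s (h.mem_stageBox_of_onSpine (onSpine_left hst)), ?_⟩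
        obtain ⟨x, j, -, ⟨h2, -⟩ | ⟨-, -, h2 | ⟨-, h2⟩⟩⟩ := h.coords_of_step hst
        · exact h.stageBox_subset_succ s (h.mem_stageBox_of_onSpine h2.1)
        · exact h.stageBox_subset_succ s (h.mem_stageBox_of_onSpine h2.1)
        · exact h.mem_stageBox_of_onSpine h2.1
      · exact ⟨h.stageBox_subset_succ s hp, h.stageBox_subset_succ s hq⟩
    rcases h.localEdge he (Or.inl hv) with h1 | h1
    exacts [⟨_, (hkey _ _ h1).2⟩, ⟨_, (hkey _ _ h1).1⟩]
  refine ⟨hbox, ?_⟩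
  obtain ⟨t, hw⟩ := hbox
  have hkey : ∀ r p q, (∀ a, (a = p ∨ a = q) → r ≤ stage L X a) → LocalEdge L X r p q →
      SpineStep L X z r p q ∨ (stage L X p = r ∧ stage L X q = r ∧
        projCol L X z r p = projCol L X z r q ∧ projHeight L X r p = projHeight L X r q) := by
    rintro r p q hr (⟨h1, h2, hp, hq, h3⟩ | ⟨h1, h2, j, h3, h4, h5, h6⟩ | ⟨hp, hq, h1, h2, h3, h4⟩)
    · rcases le_or_gt (entryCol X z r) p.1 with h4 | h4
      · have := hq.2.1
        exact Or.inl (Or.inl ⟨h1, h2, h3, h4, by omega⟩)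
      · refine Or.inr ⟨le_antisymm (stage_le hp) (hr p (Or.inl rfl)),
          le_antisymm (stage_le hq) (hr q (Or.inr rfl)), ?_, ?_⟩
        · unfold projCol; rw [if_pos h1, if_pos h2]; omega
        · rw [projHeight_of_row h1, projHeight_of_row h2]
    · exact Or.inl (Or.inr ⟨h1, h2, j, h3, h4, h5, h6⟩)
    · refine Or.inr ⟨le_antisymm (stage_le hp) (hr p (Or.inl rfl)),
          le_antisymm (stage_le hq) (hr q (Or.inr rfl)), ?_, ?_⟩
      · have h5 : blockEnd r p.1 = blockEnd r q.1 := by unfold blockEnd; rw [h3]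
        unfold projCol
        split_ifs with h6 h7 h7
        · rw [(h4 (Or.inl h6)).1]
        · rw [← h5, blockEnd_eq (h4 (Or.inl h6)).2]
        · rw [← (h4 (Or.inr h7)).1, blockEnd_eq (h4 (Or.inr h7)).2]
        · rw [h5]
      · unfold projHeight; rw [if_neg h1, if_neg h2]
  set r := min (stage L X v) (stage L X w) with hr
  have hin : v ∈ stageBox L X r ∨ w ∈ stageBox L X r := by
    rcases min_choice (stage L X v) (stage L X w) with h1 | h1
    · left; rw [hr, h1]; exact mem_stageBox_stage hv
    · right; rw [hr, h1]; exact mem_stageBox_stage hw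
  rcases h.localEdge he hin with h1 | h1
  · rcases hkey r v w (by rintro a (rfl | rfl) <;> omega) h1 with h2 | ⟨h2, h3, h4, h5⟩
    · exact Or.inl ⟨r, Or.inl h2⟩
    · right; rw [h2, h3]; exact ⟨rfl, h4.symm, h5.symm⟩
  · rcases hkey r w v (by rintro a (rfl | rfl) <;> omega) h1 with h2 | ⟨h2, h3, h4, h5⟩
    · exact Or.inl ⟨r, Or.inr h2⟩
    · right; rw [h2, h3]; exact ⟨rfl, h4, h5⟩

end IsSpine

lemma prunedEdges_subset (γ : ℝ) (L X : ℕ → ℤ) : prunedEdges γ L X ⊆ etaEdges γ := Set.sdiff_subset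

namespace IsSpine

variable {L X : ℕ → ℤ} {z : V} {γ : ℝ}

lemma row_edge_mem (h : IsSpine L X z) {s : ℕ} {v w : V} (hv : v.2 = spineRow L s)
    (hw : w.2 = spineRow L s)
    (hvw : w.1 = v.1 + 1) (h1 : X (s + 1) ≤ v.1) (h2 : v.1 < cornerCol X s) :
    s(v, w) ∈ prunedEdges γ L X := by
  refine ⟨Or.inl ⟨s + 1, L (s + 1), X (s + 1), by omega, h.odd s, h.tip s, Or.inl
    ⟨(v.1 - X (s + 1)).toNat, ?_, ?_⟩⟩, ?_⟩
  · unfold cornerCol at h2; omega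
  · rw [Int.toNat_of_nonneg (by omega), add_sub_cancel, ← hvw]
    exact congrArg₂ _ (Prod.ext rfl hv) (Prod.ext rfl hw)
  · rintro ⟨k, hk, hf⟩
    have h3 : rowY k (L k) = 3 * (2 ^ (k - 1) * L k) := by unfold rowY; ring
    have h4 : spineRow L s = 3 * (2 ^ s * L (s + 1)) := by unfold spineRow; ring
    rcases trapEdge_of_mem hf with ⟨-, -, h5⟩ | ⟨-, -, h5⟩ <;> omega

lemma abutment_edge_mem (h : IsSpine L X z) {s : ℕ} {v w : V} (hv : v.1 = cornerCol X s)
    (hw : w.1 = cornerCol X s)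
    {j : ℤ} (h0 : 0 ≤ j) (hj : j < 3 * 2 ^ s) (hv' : v.2 = spineRow L s + dirF (L (s + 1)) * j)
    (hw' : w.2 = spineRow L s + dirF (L (s + 1)) * (j + 1)) : s(v, w) ∈ prunedEdges γ L X := by
  refine ⟨Or.inl ⟨s + 1, L (s + 1), X (s + 1), by omega, h.odd s, h.tip s, Or.inr
    ⟨j.toNat, ?_, ?_⟩⟩, ?_⟩
  · rw [Nat.add_sub_cancel]
    zify
    rwa [Int.toNat_of_nonneg h0]
  · rw [Int.toNat_of_nonneg h0]
    exact congrArg₂ _ (Prod.ext hv hv') (Prod.ext hw hw')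
  · rintro ⟨k, hk, hf⟩
    obtain ⟨t, rfl⟩ : ∃ t, k = t + 2 := ⟨k - 2, by omega⟩
    have h3 : cornerCol X (t + 1) + 1 - bF (t + 1) ≤ cornerCol X s ∧
        cornerCol X s < cornerCol X (t + 1) := by
      have h4 : (X (t + 2) + bF (t + 2) : ℤ) = cornerCol X (t + 1) + 1 := by unfold cornerCol; ring
      rcases trapEdge_of_mem hf with ⟨⟨h5, h6⟩, ⟨h7, h8⟩, -⟩ | ⟨⟨h5, h6⟩, ⟨h7, h8⟩, -⟩ <;>
        rw [h4, show t + 2 - 1 = t + 1 from rfl] at * <;> constructor <;> linarith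
    have h4 : s ≤ t := Nat.lt_succ_iff.1 (h.cornerCol_strictMono.lt_iff_lt.1 h3.2)
    have h5 := h.cornerCol_strictMono.monotone h4
    have h6 := h.cornerCol_add_le t
    linarith

lemma step_mem (h : IsSpine L X z) {s : ℕ} {v w : V} (hs : SpineStep L X z s v w) :
    s(v, w) ∈ prunedEdges γ L X := by
  rcases hs with ⟨h1, h2, h3, h4, h5⟩ | ⟨h1, h2, j, h3, h4, h5, h6⟩
  · exact h.row_edge_mem h1 h2 h3 ((h.tip_le_entryCol s).trans h4) h5
  · exact h.abutment_edge_mem h1 h2 h3 h4 h5 h6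

lemma exists_step {s : ℕ} {v : V} (hv : OnSpine L X z s v) : ∃ w, SpineStep L X z s v w := by
  rcases hv with ⟨h1, h2, h3⟩ | ⟨h1, j, h3, h4, h5⟩
  · rcases h3.lt_or_eq with h4 | h4
    · exact ⟨(v.1 + 1, v.2), Or.inl ⟨h1, h1, rfl, h2, h4⟩⟩
    · exact ⟨(v.1, spineRow L s + dirF (L (s + 1)) * (0 + 1)),
        Or.inr ⟨h4, h4, 0, le_rfl, by positivity, by simp [h1], rfl⟩⟩
  · exact ⟨(v.1, spineRow L s + dirF (L (s + 1)) * (j + 1)), Or.inr ⟨h1, h1, j, h3, h4, h5, rfl⟩⟩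

lemma isFlat_of_row (h : IsSpine L X z) {s : ℕ} {v : V} (hrow : v.2 = spineRow L s)
    (h1 : X (s + 1) < v.1)
    (h2 : v.1 < cornerCol X s) (hd : ¬ (bF s : ℤ) ∣ v.1 + 1) : IsFlat (prunedEdges γ L X) v := by
  have hv : v ∈ stageBox L X s := ⟨h1.le, h2.le, by rw [hrow]; simp⟩
  ext u
  simp only [Set.mem_ofPred_eq, Set.mem_insert_iff, Set.mem_singleton_iff]
  constructor
  · intro hu
    rcases h.localEdge hu (Or.inl hv) with (h3 | h3 | h3) | (h3 | h3 | h3)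
    · exact Or.inl (Prod.ext h3.2.2.2.2 (h3.2.1.trans hrow.symm))
    · exact absurd h3.1 h2.ne
    · exact absurd (h3.2.2.2.2.2 (Or.inl hrow)).2 hd
    · exact Or.inr (Prod.ext (by have := h3.2.2.2.2; simp only; omega) (h3.1.trans hrow.symm))
    · exact absurd h3.2.1 h2.ne
    · have h4 := h3.2.2.2.2.2 (Or.inr hrow)
      exact absurd (h4.1 ▸ h4.2) hd
  · rintro (rfl | rfl)
    · exact h.row_edge_mem hrow hrow rfl h1.le h2
    · rw [Sym2.eq_swap]
      exact h.row_edge_mem hrow hrow (by simp) (by simp only; omega) (by simp only; omega)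

/-- The projection of a vertex with a lateral edge is at least at the end of its block. -/
lemma blockEnd_le_projCol (h : IsSpine L X z) {s : ℕ} {v : V} (hv : v ∈ stageBox L X (s + 1))
    (hf : ¬ IsFlat (prunedEdges γ L X) v) :
    blockEnd (s + 1) v.1 ≤ projCol L X z (s + 1) v := by
  unfold projCol
  split_ifs with hrow
  · have hent : (bF (s + 1) : ℤ) ∣ entryCol X z (s + 1) + 1 := h.dvd_cornerCol_add_one le_rfl
    by_cases hd : (bF (s + 1) : ℤ) ∣ v.1 + 1
    · rw [blockEnd_eq hd]; exact le_max_right _ _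
    · have h1 : v.1 < cornerCol X (s + 1) := by
        refine lt_of_le_of_ne hv.2.1 fun he => hd ?_
        rw [he]; exact h.dvd_cornerCol
      have h2 : v.1 ≤ X (s + 1 + 1) := by
        by_contra hlt
        exact hf (h.isFlat_of_row hrow (not_le.1 hlt) h1 hd)
      exact (blockEnd_le hent (h2.trans (h.tip_le_entryCol (s + 1)))).trans (le_max_left _ _)
  · exact le_max_right _ _

end IsSpine

/-- Resistance of the part of the path consisting of the abutments of the chain from stage `s`
on. -/
def tailSum (β : ℝ) (X : ℕ → ℤ) (s : ℕ) : ℝ := ∑' i, 3 * 2 ^ (s + i) * β ^ (-cornerCol X (s + i))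

/-- Resistance to infinity of the projection of a vertex to the infinite path. -/
def potential (β : ℝ) (L X : ℕ → ℤ) (z : V) (v : V) : ℝ :=
  β ^ (-projCol L X z (stage L X v) v) / (β - 1) + tailSum β X (stage L X v) -
    projHeight L X (stage L X v) v * β ^ (-cornerCol X (stage L X v))

/-- Uniform bound for the normalized resistance of the later abutments. -/
def abutmentConst (β : ℝ) : ℝ := ∑' m : ℕ, 3 * 2 ^ m * β ^ (-(bF m : ℤ))

lemma two_pow_le_bF (m : ℕ) : 2 ^ m ≤ bF m := by
  induction m with
  | zero => decide
  | succ m ih =>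
    rw [pow_succ, bF_succ]
    rcases Nat.eq_zero_or_pos m with rfl | hm
    · decide
    · have : 3 ≤ 3 ^ m := Nat.le_self_pow (by omega) 3
      nlinarith

lemma bF_succ_strictMono : StrictMono fun k => bF (k + 1) := by
  refine strictMono_nat_of_lt_succ fun k => ?_
  have h1 := three_mul_bF_le (k := k + 1) (by omega)
  have h2 := bF_pos (k + 1)
  omega

lemma summable_abutment {β : ℝ} (hβ : 1 < β) :
    Summable fun m : ℕ => 3 * 2 ^ m * β ^ (-(bF m : ℤ)) := by
  rw [← summable_nat_add_iff 1]
  have hβ0 : 0 < β := by linarith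
  have h1 : Summable fun n : ℕ => (n : ℝ) * β⁻¹ ^ n := by
    have h2 := summable_pow_mul_geometric_of_norm_lt_one (R := ℝ) 1 (r := β⁻¹)
      (by rw [Real.norm_of_nonneg (by positivity)]; exact inv_lt_one_of_one_lt₀ hβ)
    simpa using h2
  refine Summable.of_nonneg_of_le (fun m => by positivity) (fun m => ?_)
    ((h1.comp_injective bF_succ_strictMono.injective).mul_left 3)
  simp only [Function.comp]
  rw [zpow_neg, zpow_natCast, inv_pow, ← mul_assoc]
  gcongr
  exact_mod_cast two_pow_le_bF (m + 1)

namespace IsSpine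

variable {L X : ℕ → ℤ} {z : V} {γ β : ℝ}

lemma abutment_term_le (h : IsSpine L X z) (hβ : 1 < β) (s i : ℕ) :
    3 * 2 ^ (s + 1 + i) * β ^ (-cornerCol X (s + 1 + i)) ≤
    β ^ (-cornerCol X s) * (3 * 2 ^ (s + 1 + i) * β ^ (-(bF (s + 1 + i) : ℤ))) := by
  have hβ0 : 0 < β := by linarith
  rw [mul_left_comm, ← zpow_add₀ hβ0.ne']
  gcongr
  · exact hβ.le
  · have h1 := h.cornerCol_add_le (s + i)
    have h2 := h.cornerCol_strictMono.monotone (Nat.le_add_right s i)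
    rw [show s + i + 1 = s + 1 + i by ring] at h1
    linarith

lemma summable_tail (h : IsSpine L X z) (hβ : 1 < β) (s : ℕ) :
    Summable fun i => 3 * 2 ^ (s + i) * β ^ (-cornerCol X (s + i)) := by
  have hβ0 : 0 < β := by linarith
  rw [← summable_nat_add_iff 1]
  refine Summable.of_nonneg_of_le (fun m => by positivity) (fun m => ?_)
    (((summable_nat_add_iff (s + 1)).2 (summable_abutment hβ)).mul_left (β ^ (-cornerCol X s)))
  have := h.abutment_term_le hβ s m
  rw [show m + (s + 1) = s + (m + 1) by ring]
  rwa [show s + 1 + m = s + (m + 1) by ring] at this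

lemma tailSum_eq (h : IsSpine L X z) (hβ : 1 < β) (s : ℕ) :
    tailSum β X s = 3 * 2 ^ s * β ^ (-cornerCol X s) + tailSum β X (s + 1) := by
  unfold tailSum
  rw [(h.summable_tail hβ s).tsum_eq_zero_add]
  congr 2
  ext i
  rw [show s + (i + 1) = s + 1 + i by ring]

lemma tailSum_nonneg (hβ : 1 < β) (s : ℕ) : 0 ≤ tailSum β X s :=
  tsum_nonneg fun _ => by have : 0 < β := by linarith
                          positivity

lemma tailSum_le (h : IsSpine L X z) (hβ : 1 < β) (s : ℕ) :
    tailSum β X s ≤ β ^ (-cornerCol X s) * (3 * 2 ^ s + abutmentConst β) := by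
  have hβ0 : 0 < β := by linarith
  have hs := summable_abutment hβ
  have hs' := (summable_nat_add_iff (s + 1)).2 hs
  have h1 : tailSum β X (s + 1) ≤ β ^ (-cornerCol X s) * abutmentConst β := by
    unfold tailSum abutmentConst
    rw [← tsum_mul_left]
    rw [← (hs.mul_left (β ^ (-cornerCol X s))).sum_add_tsum_nat_add (s + 1)]
    refine le_add_of_nonneg_of_le (Finset.sum_nonneg fun _ _ => by positivity) ?_
    refine Summable.tsum_le_tsum (fun i => ?_) (h.summable_tail hβ (s + 1)) (hs'.mul_left _)
    have := h.abutment_term_le hβ s i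
    rwa [add_comm i (s + 1)]
  rw [h.tailSum_eq hβ s, mul_add]
  linarith

lemma potential_nonneg (h : IsSpine L X z) (hβ : 1 < β) {s : ℕ} {v : V} (hv : v ∈ stageBox L X s) :
    0 ≤ potential β L X z v := by
  have hβ0 : 0 < β := by linarith
  have hβ1 : 0 < β - 1 := by linarith
  have h1 := projHeight_lt (mem_stageBox_stage hv)
  unfold potential
  set t := stage L X v
  have h2 : (projHeight L X t v : ℝ) ≤ 3 * 2 ^ t := by exact_mod_cast h1.le
  have h3 : (projHeight L X t v : ℝ) * β ^ (-cornerCol X t) ≤ 3 * 2 ^ t * β ^ (-cornerCol X t) := by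
    gcongr
  have h4 := tailSum_nonneg (X := X) hβ (t + 1)
  have h5 : 0 ≤ β ^ (-projCol L X z t v) / (β - 1) := by positivity
  rw [h.tailSum_eq hβ t]
  linarith

lemma potential_le (h : IsSpine L X z) (hβ : 1 < β) {s : ℕ} {v : V} (hv : v ∈ stageBox L X s)
    (hs : stage L X v = s) :
    potential β L X z v ≤
      β ^ (-projCol L X z s v) * (1 / (β - 1) + (3 * 2 ^ s + abutmentConst β)) := by
  have hβ0 : 0 < β := by linarith
  have h1 := h.tailSum_le hβ s
  have h2 : (0 : ℝ) ≤ projHeight L X s v := by exact_mod_cast projHeight_nonneg s v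
  have h3 : (0 : ℝ) ≤ projHeight L X s v * β ^ (-cornerCol X s) := by positivity
  have hC : 0 ≤ abutmentConst β := tsum_nonneg fun _ => by positivity
  have h4 : β ^ (-cornerCol X s) * (3 * 2 ^ s + abutmentConst β) ≤
      β ^ (-projCol L X z s v) * (3 * 2 ^ s + abutmentConst β) := by
    gcongr
    · exact hβ.le
    · exact h.projCol_le hv.2.1
  unfold potential
  rw [hs, mul_add, mul_one_div]
  linarith

lemma potential_eq (h : IsSpine L X z) {v : V} {s : ℕ} {x j : ℤ} (hv : Coords L X z v s x j) :
    potential β L X z v = β ^ (-x) / (β - 1) + tailSum β X s - j * β ^ (-cornerCol X s) := by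
  unfold potential
  rw [h.stage_eq hv.1, hv.2.1, hv.2.2]

lemma potential_sub_of_step (h : IsSpine L X z) (hβ : 1 < β) {s : ℕ} {v w : V}
    (hv : SpineStep L X z s v w) :
    β ^ (max v.1 w.1) * (potential β L X z v - potential β L X z w) = 1 := by
  have hβ0 : β ≠ 0 := by linarith
  have hβ1 : β - 1 ≠ 0 := by linarith
  obtain ⟨x, j, h1, ⟨h2, hm⟩ | ⟨hx, hm, h2 | ⟨hj, h2⟩⟩⟩ := h.coords_of_step hv
  all_goals rw [h.potential_eq h1, h.potential_eq h2, hm]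
  · rw [neg_add, zpow_add₀ hβ0, zpow_add₀ hβ0, zpow_neg]
    simp only [zpow_one, zpow_neg]
    field_simp
    ring
  · rw [hx, zpow_neg]
    push_cast
    field_simp
    ring
  · have hj' : (j : ℝ) + 1 = 3 * 2 ^ s := by exact_mod_cast hj
    rw [h.tailSum_eq hβ s, ← hj', hx, zpow_neg]
    push_cast
    field_simp
    ring

end IsSpine

namespace IsSpine

variable {L X : ℕ → ℤ} {z : V} {γ β : ℝ}

lemma step_unique_right (h : IsSpine L X z) {s t : ℕ} {v w w' : V} (hw : SpineStep L X z s v w)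
    (hw' : SpineStep L X z t v w') : w = w' := by
  obtain ⟨r, hr⟩ := h.exists_onSpine_right hw
  obtain ⟨r', hr'⟩ := h.exists_onSpine_right hw'
  exact h.onSpine_injective hr hr' (by rw [h.pathPos_of_step hw, h.pathPos_of_step hw'])

lemma step_unique_left (h : IsSpine L X z) {s t : ℕ} {v v' w : V} (hv : SpineStep L X z s v w)
    (hv' : SpineStep L X z t v' w) : v = v' := by
  refine h.onSpine_injective (onSpine_left hv) (onSpine_left hv') ?_
  have h1 := h.pathPos_of_step hv
  have h2 := h.pathPos_of_step hv'
  linarith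

lemma not_step_start (h : IsSpine L X z) {s : ℕ} {v : V} : ¬ SpineStep L X z s v z := fun hv => by
  have h1 := h.pathPos_start_le (h.mem_stageBox_of_onSpine (onSpine_left hv))
  have h2 := h.pathPos_of_step hv
  linarith

lemma flow_eq (h : IsSpine L X z) (hβ : 1 < β) {s : ℕ} {v w : V} (hv : v ∈ stageBox L X s) :
    (∃ t, SpineStep L X z t v w) ∧
      conductance β (prunedEdges γ L X) v w * (potential β L X z v - potential β L X z w) = 1 ∨
    (∃ t, SpineStep L X z t w v) ∧
      conductance β (prunedEdges γ L X) v w * (potential β L X z v - potential β L X z w) = -1 ∨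
    conductance β (prunedEdges γ L X) v w * (potential β L X z v - potential β L X z w) = 0 := by
  by_cases he : s(v, w) ∈ prunedEdges γ L X
  · rw [conductance_of_mem he]
    rcases (h.edge_cases he hv).2 with ⟨t, ht | ht⟩ | ⟨h1, h2, h3⟩
    · exact Or.inl ⟨⟨t, ht⟩, h.potential_sub_of_step hβ ht⟩
    · refine Or.inr (Or.inl ⟨⟨t, ht⟩, ?_⟩)
      have := h.potential_sub_of_step hβ ht
      rw [max_comm]
      linarith
    · refine Or.inr (Or.inr ?_)
      unfold potential
      rw [h1, h2, h3, sub_self, mul_zero]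
  · rw [conductance_of_notMem he, zero_mul]
    exact Or.inr (Or.inr rfl)

lemma superharmonic (h : IsSpine L X z) (hβ : 1 < β) {s : ℕ} {v : V} (hv : v ∈ stageBox L X s) :
    ∑ w ∈ nbrs v, conductance β (prunedEdges γ L X) v w * potential β L X z w +
      (if v = z then 1 else 0) ≤
    totalCond β (prunedEdges γ L X) v * potential β L X z v := by
  set G := prunedEdges γ L X
  set f : V → ℝ := fun w => conductance β G v w * (potential β L X z v - potential β L X z w)
    with hf
  have hflow : ∀ w, (∃ t, SpineStep L X z t v w) ∧ f w = 1 ∨ (∃ t, SpineStep L X z t w v) ∧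
      f w = -1 ∨ f w = 0 := fun w => h.flow_eq hβ hv
  suffices hs : (if v = z then 1 else 0) ≤ ∑ w ∈ nbrs v, f w by
    have : ∑ w ∈ nbrs v, f w = totalCond β G v * potential β L X z v -
        ∑ w ∈ nbrs v, conductance β G v w * potential β L X z w := by
      rw [totalCond, Finset.sum_mul, ← Finset.sum_sub_distrib]
      exact Finset.sum_congr rfl fun w _ => mul_sub _ _ _
    linarith
  by_cases hon : ∃ t, OnSpine L X z t v
  · obtain ⟨t, ht⟩ := hon
    obtain ⟨w₀, hw₀⟩ := exists_step ht
    have hmem : w₀ ∈ nbrs v :=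
      isLatticeGraph_etaEdges γ v w₀ (prunedEdges_subset γ L X (h.step_mem hw₀))
    have hw₀1 : f w₀ = 1 := by
      have he := h.step_mem (γ := γ) hw₀
      simp only [hf]
      rw [conductance_of_mem he, h.potential_sub_of_step hβ hw₀]
    rw [← Finset.add_sum_erase _ _ hmem, hw₀1]
    have hback : ∀ w ∈ (nbrs v).erase w₀, (∃ t, SpineStep L X z t w v) ∧ f w = -1 ∨ f w = 0 := by
      intro w hw
      rcases hflow w with ⟨⟨r, hr⟩, -⟩ | h1
      · exact absurd (h.step_unique_right hr hw₀) (Finset.ne_of_mem_erase hw)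
      · exact h1
    by_cases hb : ∃ w₁ ∈ (nbrs v).erase w₀, f w₁ ≠ 0
    · obtain ⟨w₁, hw₁, hne⟩ := hb
      obtain ⟨⟨r, hr⟩, h1⟩ := (hback w₁ hw₁).resolve_right hne
      rw [Finset.sum_eq_single_of_mem w₁ hw₁, h1, if_neg]
      · norm_num
      · rintro rfl; exact h.not_step_start hr
      · intro w hw hww
        rcases hback w hw with ⟨⟨r', hr'⟩, -⟩ | h2
        · exact absurd (h.step_unique_left hr' hr) hww
        · exact h2
    · push Not at hb
      rw [Finset.sum_eq_zero hb]
      split_ifs <;> norm_num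
  · have h0 : ∀ w ∈ nbrs v, f w = 0 := by
      intro w _
      rcases hflow w with ⟨⟨r, hr⟩, -⟩ | ⟨⟨r, hr⟩, -⟩ | h1
      · exact absurd ⟨r, onSpine_left hr⟩ hon
      · exact absurd (h.exists_onSpine_right hr) hon
      · exact h1
    rw [Finset.sum_eq_zero h0, if_neg]
    rintro rfl
    exact hon ⟨0, h.onSpine_start⟩

lemma pathPos_le_of_edge (h : IsSpine L X z) {s : ℕ} {v w : V} (he : s(v, w) ∈ prunedEdges γ L X)
    (hv : v ∈ stageBox L X s) : pathPos L X z w ≤ pathPos L X z v + 1 := by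
  rcases (h.edge_cases he hv).2 with ⟨t, ht | ht⟩ | ⟨h1, h2, h3⟩
  · exact (h.pathPos_of_step ht).le
  · have := h.pathPos_of_step ht
    linarith
  · unfold pathPos
    rw [h1, h2, h3]
    linarith

/-- A path from `z` of length less than `b_{K+2}` stays in the box of stage `K + 2`. -/
lemma stage_le_of_path (h : IsSpine L X z) {ω : ℕ → V} (h0 : ω 0 = z)
    (hω : ∀ n, s(ω n, ω (n + 1)) ∈ prunedEdges γ L X) (n : ℕ) :
    (∃ s, ω n ∈ stageBox L X s) ∧ ∀ K, n < bF (K + 2) → stage L X (ω n) ≤ K + 2 := by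
  have hpos : ∀ n, (∃ s, ω n ∈ stageBox L X s) ∧ pathPos L X z (ω n) ≤ z.1 + 3 + n := by
    intro n
    induction n with
    | zero =>
      rw [h0]
      refine ⟨⟨0, h.mem_stageBox_of_onSpine h.onSpine_start⟩, ?_⟩
      rw [h.pathPos_start]; simp
    | succ n ih =>
      obtain ⟨⟨s, hs⟩, hp⟩ := ih
      refine ⟨(h.edge_cases (hω n) hs).1, (h.pathPos_le_of_edge (hω n) hs).trans ?_⟩
      push_cast; linarith
  refine ⟨(hpos n).1, fun K hK => ?_⟩
  obtain ⟨⟨s, hs⟩, hp⟩ := hpos n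
  by_contra hlt
  push Not at hlt
  have h1 := (h.pathPos_bounds (mem_stageBox_stage hs) rfl).1
  have h2 := h.entry_mono (show K + 1 + 1 + 1 ≤ stage L X (ω n) from hlt)
  have h3 := h.cornerCol_add_le (K + 1)
  have h4 := h.cornerCol_strictMono.monotone (Nat.zero_le (K + 1))
  have h5 : z.1 ≤ cornerCol X 0 := h.start.2.2
  have h6 : (n : ℤ) < bF (K + 2) := by exact_mod_cast hK
  have h7 : (1 : ℤ) ≤ 2 ^ (K + 1 + 1 + 1) := one_le_pow₀ (by norm_num)
  change cornerCol X (K + 1 + 1) + 3 * 2 ^ (K + 1 + 1 + 1) ≤ _ at h2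
  rw [show K + 1 + 1 = K + 2 from rfl] at *
  linarith

end IsSpine

/-- Each of `n` consecutive blocks contributes at most a geometric series. -/
lemma sum_zpow_sub_blockEnd_le {β : ℝ} (hβ : 1 < β) (s n : ℕ) {a : ℤ} (ha : (bF s : ℤ) ∣ a) :
    ∑ x ∈ Finset.Icc a (a + n * bF s - 1), β ^ (x - blockEnd s x) ≤ n * (1 - β⁻¹)⁻¹ := by
  have hβ0 : 0 < β := by linarith
  have hlt : β⁻¹ < 1 := inv_lt_one_of_one_lt₀ hβ
  have hp : (0 : ℤ) < bF s := by exact_mod_cast bF_pos s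
  obtain ⟨t, rfl⟩ := ha
  have hmaps : ∀ x ∈ Finset.Icc (bF s * t) (bF s * t + n * bF s - 1),
      x / bF s ∈ Finset.Ico t (t + n) := by
    intro x hx
    rw [Finset.mem_Icc] at hx
    rw [Finset.mem_Ico, Int.le_ediv_iff_mul_le hp, Int.ediv_lt_iff_lt_mul hp]
    constructor <;> linarith
  rw [← Finset.sum_fiberwise_of_maps_to hmaps]
  have hcard : (Finset.Ico t (t + n)).card = n := by simp
  conv_rhs => rw [← hcard, ← nsmul_eq_mul]
  refine Finset.sum_le_card_nsmul _ _ _ fun q _ => ?_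
  set A := Finset.filter (fun x => x / (bF s : ℤ) = q)
    (Finset.Icc (bF s * t) (bF s * t + n * bF s - 1)) with hA
  have hinj : Set.InjOn (fun x => (blockEnd s x - x).toNat) A := by
    intro x hx y hy hxy
    have h1 := le_blockEnd s x
    have h2 := le_blockEnd s y
    have h3 : blockEnd s x = blockEnd s y := by
      unfold blockEnd
      rw [(Finset.mem_filter.1 hx).2, (Finset.mem_filter.1 hy).2]
    simp only at hxy
    omega
  have hsum : ∑ x ∈ A, β ^ (x - blockEnd s x) =
      ∑ i ∈ A.image (fun x => (blockEnd s x - x).toNat), β⁻¹ ^ i := by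
    rw [Finset.sum_image hinj]
    refine Finset.sum_congr rfl fun x _ => ?_
    rw [← zpow_natCast, Int.toNat_of_nonneg (sub_nonneg.2 (le_blockEnd s x)), inv_zpow', neg_sub]
  rw [hsum, ← tsum_geometric_of_lt_one (by positivity) hlt]
  exact (summable_geometric_of_lt_one (by positivity) hlt).sum_le_tsum _ fun i _ => by positivity

open scoped Classical in
/-- The vertices first appearing in the box of stage `s` that are not flat. -/
def roughSet (γ : ℝ) (L X : ℕ → ℤ) (s : ℕ) : Finset V :=
  (Finset.Icc (X (s + 1)) (cornerCol X s) ×ˢ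
    Finset.Ioo (spineRow L s - 3 * 2 ^ s) (spineRow L s + 3 * 2 ^ s)).filter
    fun v => stage L X v = s ∧ ¬ IsFlat (prunedEdges γ L X) v

lemma mem_roughSet {γ : ℝ} {L X : ℕ → ℤ} {s : ℕ} {v : V} : v ∈ roughSet γ L X s ↔
    v ∈ stageBox L X s ∧ stage L X v = s ∧ ¬ IsFlat (prunedEdges γ L X) v := by
  unfold roughSet stageBox
  simp only [Finset.mem_filter, Finset.mem_product, Finset.mem_Icc, Finset.mem_Ioo,
    Set.mem_ofPred_eq, abs_lt]
  constructor
  · rintro ⟨⟨⟨h1, h2⟩, h3, h4⟩, h5⟩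
    exact ⟨⟨h1, h2, by linarith, by linarith⟩, h5⟩
  · rintro ⟨⟨h1, h2, h3, h4⟩, h5⟩
    exact ⟨⟨⟨h1, h2⟩, by linarith, by linarith⟩, h5⟩

namespace IsSpine

variable {L X : ℕ → ℤ} {z : V} {γ β : ℝ}

lemma weight_le (h : IsSpine L X z) (hβ : 1 < β) {s : ℕ} {v : V} (hv : v ∈ roughSet γ L X (s + 1)) :
    totalCond β (prunedEdges γ L X) v * potential β L X z v ≤
      4 * β * (1 / (β - 1) + (3 * 2 ^ (s + 1) + abutmentConst β)) *
        β ^ (v.1 - blockEnd (s + 1) v.1) := by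
  have hβ0 : 0 < β := by linarith
  have hβ1 : 0 < β - 1 := by linarith
  have hC : 0 ≤ abutmentConst β := tsum_nonneg fun _ => by positivity
  obtain ⟨h1, h2, h3⟩ := mem_roughSet.1 hv
  have h4 : β ^ (-projCol L X z (s + 1) v) ≤ β ^ (-blockEnd (s + 1) v.1) :=
    zpow_le_zpow_right₀ hβ.le (neg_le_neg (h.blockEnd_le_projCol h1 h3))
  calc totalCond β (prunedEdges γ L X) v * potential β L X z v
      ≤ 4 * β * β ^ v.1 * (β ^ (-blockEnd (s + 1) v.1) *
          (1 / (β - 1) + (3 * 2 ^ (s + 1) + abutmentConst β))) := by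
        refine mul_le_mul (totalCond_le hβ v) ((h.potential_le hβ h1 h2).trans ?_)
          (h.potential_nonneg hβ h1) (by positivity)
        gcongr
    _ = _ := by
        rw [sub_eq_add_neg v.1, zpow_add₀ hβ0.ne']
        ring

lemma exists_sum_roughSet_le (h : IsSpine L X z) (hβ : 1 < β) : ∃ c :
    ℝ, 0 ≤ c ∧ ∀ s, ∑ v ∈ roughSet γ L X s,
    totalCond β (prunedEdges γ L X) v * potential β L X z v ≤ c * 12 ^ s := by
  have hβ0 : 0 < β := by linarith
  have hβ1 : 0 < β - 1 := by linarith
  have hg : 0 < 1 - β⁻¹ := sub_pos.2 (inv_lt_one_of_one_lt₀ hβ)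
  have hC : 0 ≤ abutmentConst β := tsum_nonneg fun _ => by positivity
  set c₀ := ∑ v ∈ roughSet γ L X 0, totalCond β (prunedEdges γ L X) v * potential β L X z v
  set c₁ := 24 * β * (1 / (β - 1) + (3 + abutmentConst β)) * (1 - β⁻¹)⁻¹ with hc₁
  have hc₁0 : 0 ≤ c₁ := by positivity
  refine ⟨max c₀ c₁, le_max_of_le_right hc₁0, fun s => ?_⟩
  cases s with
  | zero => rw [pow_zero, mul_one]; exact le_max_left _ _
  | succ s =>
    set E := 1 / (β - 1) + (3 * 2 ^ (s + 1) + abutmentConst β) with hE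
    have hE0 : 0 ≤ E := by positivity
    have hE1 : E ≤ 2 ^ (s + 1) * (1 / (β - 1) + (3 + abutmentConst β)) := by
      have h1 : (1 : ℝ) ≤ 2 ^ (s + 1) := one_le_pow₀ (by norm_num)
      have h2 : 0 ≤ 1 / (β - 1) := by positivity
      rw [hE]
      nlinarith
    have hcorner : cornerCol X (s + 1) =
        X (s + 1 + 1) + (3 ^ (s + 1) : ℕ) * bF (s + 1) - 1 := by
      unfold cornerCol
      rw [bF_succ (s + 1)]; push_cast; rfl
    have hdvd : (bF (s + 1) : ℤ) ∣ X (s + 1 + 1) :=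
      dvd_trans (by exact_mod_cast bF_dvd_bF (Nat.le_succ _)) (h.tip (s + 1)).dvd
    have hcol := sum_zpow_sub_blockEnd_le hβ (s + 1) (3 ^ (s + 1)) hdvd
    rw [← hcorner] at hcol
    calc ∑ v ∈ roughSet γ L X (s + 1),
          totalCond β (prunedEdges γ L X) v * potential β L X z v
        ≤ ∑ v ∈ roughSet γ L X (s + 1), 4 * β * E * β ^ (v.1 - blockEnd (s + 1) v.1) :=
          Finset.sum_le_sum fun v hv => h.weight_le hβ hv
      _ ≤ ∑ v ∈ Finset.Icc (X (s + 1 + 1)) (cornerCol X (s + 1)) ×ˢ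
            Finset.Ioo (spineRow L (s + 1) - 3 * 2 ^ (s + 1)) (spineRow L (s + 1) + 3 * 2 ^ (s + 1)),
            4 * β * E * β ^ (v.1 - blockEnd (s + 1) v.1) :=
          Finset.sum_le_sum_of_subset_of_nonneg (by
            classical exact Finset.filter_subset _ _) fun v _ _ => by positivity
      _ = (Finset.Ioo (spineRow L (s + 1) - 3 * 2 ^ (s + 1))
            (spineRow L (s + 1) + 3 * 2 ^ (s + 1))).card * (4 * β * E *
            ∑ x ∈ Finset.Icc (X (s + 1 + 1)) (cornerCol X (s + 1)),
              β ^ (x - blockEnd (s + 1) x)) := by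
          rw [Finset.sum_product_right]
          simp only [Finset.sum_const, nsmul_eq_mul, Finset.mul_sum]
      _ ≤ (6 * 2 ^ (s + 1)) * (4 * β * (2 ^ (s + 1) * (1 / (β - 1) + (3 + abutmentConst β))) *
            ((3 ^ (s + 1) : ℕ) * (1 - β⁻¹)⁻¹)) := by
          have hcard : ((Finset.Ioo (spineRow L (s + 1) - 3 * 2 ^ (s + 1))
              (spineRow L (s + 1) + 3 * 2 ^ (s + 1))).card : ℝ) ≤ 6 * 2 ^ (s + 1) := by
            rw [Int.card_Ioo]
            have h1 : (spineRow L (s + 1) + 3 * 2 ^ (s + 1) -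
                (spineRow L (s + 1) - 3 * 2 ^ (s + 1)) - 1).toNat ≤ 6 * 2 ^ (s + 1) := by
              zify
              have : (0 : ℤ) < 2 ^ (s + 1) := by positivity
              omega
            exact_mod_cast h1
          gcongr
      _ = c₁ * 12 ^ (s + 1) := by
          rw [hc₁, show (12 : ℝ) = 2 * 2 * 3 by norm_num, mul_pow, mul_pow]
          push_cast
          ring
      _ ≤ _ := by gcongr; exact le_max_right _ _

end IsSpine

lemma summable_twelve_pow_div_bF (c : ℝ) :
    Summable fun K : ℕ => c * 12 ^ (K + 3) / (bF (K + 1) : ℝ) := by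
  have hs : Summable fun K : ℕ => (12 : ℝ) ^ (K + 3) / (bF (K + 1) : ℝ) := by
    refine summable_of_ratio_norm_eventually_le (r := 1 / 2) (by norm_num) ?_
    filter_upwards [eventually_ge_atTop 2] with K hK
    have h1 : (0 : ℝ) < bF (K + 1) := by exact_mod_cast bF_pos _
    have h2 : (27 : ℝ) ≤ 3 ^ (K + 1) := by
      calc (27 : ℝ) = 3 ^ 3 := by norm_num
        _ ≤ 3 ^ (K + 1) := pow_le_pow_right₀ (by norm_num) (by omega)
    rw [Real.norm_of_nonneg (by positivity), Real.norm_of_nonneg (by positivity), bF_succ (K + 1)]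
    push_cast
    rw [show K + 1 + 3 = (K + 3) + 1 by ring, pow_succ, div_le_iff₀ (by positivity)]
    field_simp
    nlinarith
  simpa only [mul_div_assoc] using hs.mul_left c

/-- Proposition 5.1. Fix `γ > 1` and `β > 1`. Removing from η = η(γ) every trap anchored on
the unique self-avoiding infinite path `P` started at a vertex `z` on the main part of an
order-1 branch (i.e. the traps of the branches of the chain traversed by `P`), the β-biased
random walk started at `z` a.s. has asymptotic speed `(β-1)/(β+1)`. -/
theorem speed_without_path_traps (γ : ℝ) (hγ : 1 < γ) (β : ℝ) (hβ : 1 < β)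
    (l x : ℤ) (hl : Odd l) (hx : IsTip 1 x) (z : V) (hz : OnMainPart 1 l x z)
    (L X : ℕ → ℤ) (hL1 : L 1 = l) (hX1 : X 1 = x) (hchain : IsBranchChain L X)
    (μ : Measure (ℕ → V))
    (hμ : IsWalkLaw β
      (etaEdges γ \ {f | ∃ k : ℕ, 2 ≤ k ∧ f ∈ branchTrap γ k (L k) (X k)}) z μ) :
    ∀ᵐ ω ∂μ, Tendsto (fun t : ℕ => ((ω t).1 : ℝ) / t) atTop
      (nhds ((β - 1) / (β + 1))) := by
  subst hL1 hX1
  have h : IsSpine L X z := ⟨hl, hx, hchain, hz⟩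
  obtain ⟨c, hc, hsum⟩ := h.exists_sum_roughSet_le (γ := γ) hβ
  obtain ⟨w₀, hw₀⟩ := IsSpine.exists_step h.onSpine_start
  refine IsWalkLaw.ae_speed_of_superharmonic (G := prunedEdges γ L X) hμ hβ
    (fun v w hvw => isLatticeGraph_etaEdges γ v w (prunedEdges_subset γ L X hvw))
    ⟨w₀, h.step_mem hw₀⟩ {v | ∃ s, v ∈ stageBox L X s} ?_ (potential β L X z) ?_ ?_
    (T := fun K => bF (K + 1)) bF_succ_strictMono (bF_pos 1)
    (fun K => (Finset.range (K + 3)).biUnion (roughSet γ L X)) ?_ ?_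
    (a := fun K => c * 12 ^ (K + 3)) ?_ (summable_twelve_pow_div_bF c)
  · rintro v ⟨s, hv⟩ w hvw
    exact (h.edge_cases hvw hv).1
  · rintro v ⟨s, hv⟩
    exact h.potential_nonneg hβ hv
  · rintro v ⟨s, hv⟩ -
    exact h.superharmonic hβ hv
  · intro K v hv
    obtain ⟨s, -, hv⟩ := Finset.mem_biUnion.1 hv
    exact ⟨s, (mem_roughSet.1 hv).1⟩
  · intro ω h0 hω K n hn hf
    obtain ⟨⟨s, hs⟩, hst⟩ := h.stage_le_of_path h0 hω n
    exact Finset.mem_biUnion.2 ⟨stage L X (ω n),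
      Finset.mem_range.2 (Nat.lt_succ_of_le (hst K hn)),
      mem_roughSet.2 ⟨mem_stageBox_stage hs, rfl, hf⟩⟩
  · intro K
    rw [Finset.sum_biUnion]
    · refine (Finset.sum_le_sum fun s _ => hsum s).trans ?_
      rw [← Finset.mul_sum]
      gcongr
      have := geom_sum_eq (show (12 : ℝ) ≠ 1 by norm_num) (K + 3)
      have h1 : (0 : ℝ) < 12 ^ (K + 3) := by positivity
      rw [this]
      linarith
    · intro s _ t _ hst
      refine Finset.disjoint_left.2 fun v hv hv' => hst ?_
      rw [← (mem_roughSet.1 hv).2.1, (mem_roughSet.1 hv').2.1]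

end
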